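/- arXiv:2112.09962 — 2 statements merged into one kernel-verified Lean document; each statement's English description precedes it below -/
import Mathlib

section
/- Let α ≥ -1, p > 2 and let n ≥ 0 be an integer. Then the following three quantities are equal: (i) the supremum of ‖f‖_{A^p_{(p/2)(α+2)−2}} over all f holomorphic on 𝔻 with ‖f‖_{A²_α} ≤ 1; (ii) the supremum of F_p(f)^{1/p} over all f holomorphic on 𝔻 with ‖f‖_{A²_α} ≤ 1; (iii) the supremum of G_p(f)^{1/p} over all f holomorphic on 𝔻 with ‖f‖_{A²_α} ≤ 1 and f^{(j)}(0) = 0 for all 0 ≤ j ≤ n. -/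
open MeasureTheory Set Filter
open scoped ENNReal NNReal Topology

noncomputable section

/-- The open unit disk in `ℂ`. -/
def unitDisk : Set ℂ := Metric.ball 0 1

/-- `c_β(n) = Γ(n+β)/(Γ(β)·n!)`. -/
def ccoef (β : ℝ) (n : ℕ) : ℝ := Real.Gamma (n + β) / (Real.Gamma β * n.factorial)

/-- The `n`-th Taylor coefficient of `f` at the origin. -/
def taylorCoeff (f : ℂ → ℂ) (n : ℕ) : ℂ := iteratedDeriv n f 0 / n.factorial

/-- The square of the `A²_α` norm, `∑ |a_n|²/c_{α+2}(n)`, valued in `[0,∞]`. -/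
def A2normSq (α : ℝ) (f : ℂ → ℂ) : ℝ≥0∞ :=
  ∑' n : ℕ, ENNReal.ofReal (‖taylorCoeff f n‖ ^ 2 / ccoef (α + 2) n)

/-- The `A²_α` norm (Hardy `H²` norm when `α = -1`). -/
def A2norm (α : ℝ) (f : ℂ → ℂ) : ℝ≥0∞ := A2normSq α f ^ (1 / 2 : ℝ)

/-- The `p`-th power of the weighted Bergman norm `‖f‖_{A^p_β}`, valued in `[0,∞]`:
`(β+1) ∫_𝔻 (1-|z|²)^β |f z|^p dA(z)` with `dA` the normalized area measure. -/
def ApIntPow (p β : ℝ) (f : ℂ → ℂ) : ℝ≥0∞ :=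
  ENNReal.ofReal (β + 1) *
    (∫⁻ z in unitDisk, ENNReal.ofReal ((1 - ‖z‖ ^ 2) ^ β * ‖f z‖ ^ p)) / ENNReal.ofReal Real.pi

/-- The weighted Bergman norm `‖f‖_{A^p_β}`, valued in `[0,∞]`. -/
def ApNorm (p β : ℝ) (f : ℂ → ℂ) : ℝ≥0∞ := ApIntPow p β f ^ (1 / p)

/-- The inner integral `∫₀¹ s^{α+1}/(1-(1-|z|²)s) ds`, valued in `[0,∞]`. -/
def Hinner (α : ℝ) (z : ℂ) : ℝ≥0∞ :=
  ∫⁻ s in Set.Ioo (0 : ℝ) 1, ENNReal.ofReal (s ^ (α + 1) / (1 - (1 - ‖z‖ ^ 2) * s))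

/-- The quantity `F_p(f)`. -/
def Ffun (α p : ℝ) (f : ℂ → ℂ) : ℝ≥0∞ :=
  ENNReal.ofReal (‖f 0‖ ^ p) +
    ENNReal.ofReal (p / 2) *
      (∫⁻ z in unitDisk,
        ENNReal.ofReal (‖deriv f z‖ ^ 2 * ‖f z‖ ^ (p - 2) * (1 - ‖z‖ ^ 2) ^ (p * (α + 2) / 2)) *
          Hinner α z) / ENNReal.ofReal Real.pi

/-- The quantity `G_p(f)`. -/
def Gfun (α p : ℝ) (f : ℂ → ℂ) : ℝ≥0∞ :=
  ENNReal.ofReal (p / (2 * (α + 2))) *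
    (∫⁻ z in unitDisk,
      ENNReal.ofReal (‖deriv f z‖ ^ 2 * ‖f z‖ ^ (p - 2) * (1 - ‖z‖ ^ 2) ^ (p * (α + 2) / 2))) /
    ENNReal.ofReal Real.pi

/-- Fundamental theorem of calculus for a nonnegative derivative, as a lower Lebesgue integral. -/
lemma lintegral_Ioc_of_hasDerivAt_of_nonneg {g g' : ℝ → ℝ} {a b : ℝ} (hab : a ≤ b)
    (hc : ContinuousOn g (Icc a b)) (hd : ∀ x ∈ Ioo a b, HasDerivAt g (g' x) x)
    (h0 : ∀ x ∈ Ioo a b, 0 ≤ g' x) :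
    ∫⁻ x in Ioc a b, ENNReal.ofReal (g' x) = ENNReal.ofReal (g b - g a) := by
  have hi := intervalIntegral.integrableOn_deriv_of_nonneg hc hd h0
  have h1 := intervalIntegral.integral_eq_sub_of_hasDerivAt_of_le hab hc hd
    ((intervalIntegrable_iff_integrableOn_Ioc_of_le hab).2 hi)
  rw [intervalIntegral.integral_of_le hab] at h1
  rw [← h1, ofReal_integral_eq_lintegral_ofReal hi]
  rw [← restrict_Ioo_eq_restrict_Ioc]
  filter_upwards [ae_restrict_mem measurableSet_Ioo] with x hx using h0 x hx

lemma lintegral_Iio_of_hasDerivAt_of_nonneg {g g' : ℝ → ℝ} {b L : ℝ}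
    (hc : ContinuousOn g (Iic b)) (hd : ∀ x < b, HasDerivAt g (g' x) x)
    (h0 : ∀ x < b, 0 ≤ g' x) (hL : Tendsto g atBot (𝓝 L)) :
    ∫⁻ x in Iio b, ENNReal.ofReal (g' x) = ENNReal.ofReal (g b - L) := by
  have key : ∀ n : ℕ, ∫⁻ x in Ioc (b - n) b, ENNReal.ofReal (g' x)
      = ENNReal.ofReal (g b - g (b - n)) := fun n =>
    lintegral_Ioc_of_hasDerivAt_of_nonneg (by simp) (hc.mono fun x hx => hx.2)
      (fun x hx => hd x hx.2) (fun x hx => h0 x hx.2)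
  have hU : ⋃ n : ℕ, Ioc (b - (n : ℝ)) b = Iic b := by
    ext x
    simp only [mem_iUnion, mem_Ioc, mem_Iic]
    refine ⟨fun ⟨n, hn⟩ => hn.2, fun hx => ?_⟩
    obtain ⟨n, hn⟩ := exists_nat_gt (b - x)
    exact ⟨n, by linarith, hx⟩
  have hmono : Monotone fun n : ℕ => Ioc (b - (n : ℝ)) b := by
    intro m n hmn
    have : (m : ℝ) ≤ n := by exact_mod_cast hmn
    exact Ioc_subset_Ioc_left (by linarith)
  rw [restrict_Iio_eq_restrict_Iic, ← hU]
  rw [setLIntegral_iUnion_of_directed _ hmono.directed_le]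
  simp_rw [key]
  have ht : Tendsto (fun n : ℕ => ENNReal.ofReal (g b - g (b - n))) atTop
      (𝓝 (ENNReal.ofReal (g b - L))) := by
    apply ENNReal.tendsto_ofReal
    apply Tendsto.const_sub
    apply hL.comp
    exact tendsto_atBot_add_const_left _ _
      (tendsto_neg_atTop_atBot.comp tendsto_natCast_atTop_atTop)
  refine tendsto_nhds_unique (tendsto_atTop_iSup ?_) ht
  intro m n hmn
  simp_rw [← key]
  exact lintegral_mono_set (hmono hmn)

/-- Tonelli over the region `s < t < 0`. -/
lemma lintegral_Iio_triangle_swap {W g : ℝ → ℝ≥0∞} (hW : Measurable W)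
    (hg : AEMeasurable g (volume.restrict (Iio 0))) :
    ∫⁻ t in Iio (0 : ℝ), W t * ∫⁻ s in Iio t, g s =
      ∫⁻ s in Iio (0 : ℝ), g s * ∫⁻ t in Ioo s 0, W t := by
  have h1 : ∀ t ∈ Iio (0 : ℝ), W t * ∫⁻ s in Iio t, g s =
      ∫⁻ s in Iio (0 : ℝ), (Iio t).indicator (fun s => W t * g s) s := by
    intro t ht
    rw [setLIntegral_indicator measurableSet_Iio, lintegral_const_mul'']
    · congr 2
      rw [inter_eq_left.2 (Iio_subset_Iio ht.le)]
    · exact hg.mono_measure (Measure.restrict_mono inter_subset_right le_rfl)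
  have h2 : ∀ s ∈ Iio (0 : ℝ), g s * ∫⁻ t in Ioo s 0, W t =
      ∫⁻ t in Iio (0 : ℝ), (Iio t).indicator (fun s => W t * g s) s := by
    intro s hs
    rw [← lintegral_const_mul _ hW, ← Ioi_inter_Iio,
      ← setLIntegral_indicator measurableSet_Ioi]
    refine lintegral_congr fun t => ?_
    by_cases h : s < t <;> simp [h, mul_comm]
  rw [setLIntegral_congr_fun measurableSet_Iio h1, setLIntegral_congr_fun measurableSet_Iio h2]
  refine lintegral_lintegral_swap ?_
  have : (Function.uncurry fun t s => (Iio t).indicator (fun s => W t * g s) s)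
      = {q : ℝ × ℝ | q.2 < q.1}.indicator (fun q => W q.1 * g q.2) := by
    ext q
    rcases q with ⟨t, s⟩
    by_cases h : s < t <;> simp [h, indicator]
  rw [this]
  refine AEMeasurable.indicator ?_ (measurableSet_lt measurable_snd measurable_fst)
  exact ((hW.comp measurable_fst).aemeasurable).mul hg.comp_snd

/-- Logarithmic polar coordinates on the unit disk. -/
lemma lintegral_unitDisk_eq {F : ℂ → ℝ≥0∞} (hF : Measurable (unitDisk.indicator F)) :
    ∫⁻ z in unitDisk, F z = ∫⁻ s in Iio (0 : ℝ), ENNReal.ofReal (Real.exp (2 * s)) *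
      ∫⁻ θ in Ioc (-Real.pi) Real.pi, F (Complex.exp (s + θ * Complex.I)) := by
  have hdisk : MeasurableSet unitDisk := Metric.isOpen_ball.measurableSet
  have hmem : ∀ s θ : ℝ, Complex.exp (s + θ * Complex.I) ∈ unitDisk ↔ s < 0 := by
    intro s θ
    simp [unitDisk, Complex.norm_exp]
  set K := unitDisk.indicator F with hK
  have hcurry : Measurable fun q : ℝ × ℝ => ENNReal.ofReal q.1 * K (Complex.polarCoord.symm q) := by
    refine (ENNReal.measurable_ofReal.comp measurable_fst).mul (hF.comp ?_)
    have : Continuous fun q : ℝ × ℝ => Complex.polarCoord.symm q := by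
      simp only [Complex.polarCoord_symm_apply]
      fun_prop
    exact this.measurable
  rw [← lintegral_indicator hdisk, ← Complex.lintegral_comp_polarCoord_symm]
  simp only [polarCoord_target, smul_eq_mul]
  rw [Measure.volume_eq_prod, ← Measure.prod_restrict, lintegral_prod _ hcurry.aemeasurable]
  have hexp : Ioi (0 : ℝ) = Real.exp '' univ := by simp [Real.range_exp]
  rw [hexp, lintegral_image_eq_lintegral_abs_deriv_mul MeasurableSet.univ
    (fun x _ => (Real.hasDerivAt_exp x).hasDerivWithinAt) Real.exp_injective.injOn]
  rw [Measure.restrict_univ, ← lintegral_indicator measurableSet_Iio]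
  refine lintegral_congr fun s => ?_
  have hpol : ∀ θ : ℝ, Complex.polarCoord.symm (Real.exp s, θ)
      = Complex.exp (s + θ * Complex.I) := by
    intro θ
    rw [Complex.polarCoord_symm_apply, Complex.exp_add, Complex.exp_mul_I]
    simp
  simp only [hpol]
  by_cases hs : s < 0
  · rw [indicator_of_mem (by exact hs), restrict_Ioo_eq_restrict_Ioc,
      lintegral_const_mul' _ _ ENNReal.ofReal_ne_top, ← mul_assoc, abs_of_pos (Real.exp_pos s),
      ← ENNReal.ofReal_mul (Real.exp_pos s).le, ← Real.exp_add, two_mul]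
    congr 1
    refine lintegral_congr fun θ => ?_
    rw [hK, indicator_of_mem ((hmem s θ).2 hs)]
  · rw [indicator_of_notMem (by exact hs)]
    have : ∀ θ : ℝ, K (Complex.exp (s + θ * Complex.I)) = 0 := fun θ => by
      rw [hK, indicator_of_notMem (mt (hmem s θ).1 hs)]
    simp [this]

lemma norm_exp_add_mul_I (s θ : ℝ) : ‖Complex.exp (s + θ * Complex.I)‖ = Real.exp s := by
  simp [Complex.norm_exp]

lemma exp_add_mul_I_mem_unitDisk {s : ℝ} (hs : s < 0) (θ : ℝ) :
    Complex.exp (s + θ * Complex.I) ∈ unitDisk := by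
  simpa [unitDisk, Complex.norm_exp] using hs

lemma measurableSet_unitDisk : MeasurableSet unitDisk := Metric.isOpen_ball.measurableSet

lemma measurable_indicator_of_continuousOn {F : ℂ → ℝ≥0∞} {s : Set ℂ} (hs : MeasurableSet s)
    (h : ContinuousOn F s) : Measurable (s.indicator F) := by
  classical
  rw [← piecewise_eq_indicator]
  exact h.measurable_piecewise continuousOn_const hs

/-- Change of variables along an injective holomorphic map. -/
lemma lintegral_image_eq_lintegral_norm_deriv_sq_mul {s : Set ℂ} (hs : MeasurableSet s)
    {φ φ' : ℂ → ℂ} (hφ : ∀ z ∈ s, HasDerivAt φ (φ' z) z) (hinj : InjOn φ s) (F : ℂ → ℝ≥0∞) :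
    ∫⁻ z in φ '' s, F z = ∫⁻ z in s, ENNReal.ofReal (‖φ' z‖ ^ 2) * F (φ z) := by
  rw [lintegral_image_eq_lintegral_abs_det_fderiv_mul volume hs
    (fun z hz => ((hφ z hz).hasFDerivAt.restrictScalars ℝ).hasFDerivWithinAt) hinj]
  refine lintegral_congr fun z => ?_
  congr 2
  simp only [ContinuousLinearMap.det, ContinuousLinearMap.coe_restrictScalars]
  erw [LinearMap.det_restrictScalars]
  simp [Algebra.norm_complex_eq, Complex.normSq_eq_norm_sq]

open ComplexConjugate in
lemma HasDerivAt.norm_rpow_complex {γ : ℝ → ℂ} {γ' : ℂ} {t p : ℝ} (hp : 1 < p)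
    (h : HasDerivAt γ γ' t) :
    HasDerivAt (fun s => ‖γ s‖ ^ p) (p * ‖γ t‖ ^ (p - 2) * (conj (γ t) * γ').re) t := by
  have := (hasFDerivAt_norm_rpow (γ t) hp).comp_hasDerivAt t h
  convert! this using 1
  simp [Complex.inner, mul_comm]

open ComplexConjugate in
lemma HasDerivAt.norm_rpow_mul_re_complex {γ γ' : ℝ → ℂ} {γ'' : ℂ} {t p : ℝ} (hp : 2 < p)
    (h : HasDerivAt γ (γ' t) t) (h' : HasDerivAt γ' γ'' t) :
    HasDerivAt (fun s => p * ‖γ s‖ ^ (p - 2) * (conj (γ s) * γ' s).re)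
      (p * ((p - 2) * ‖γ t‖ ^ (p - 4) * (conj (γ t) * γ' t).re ^ 2 +
        ‖γ t‖ ^ (p - 2) * (‖γ' t‖ ^ 2 + (conj (γ t) * γ'').re))) t := by
  have hR : HasDerivAt (fun s => (conj (γ s) * γ' s).re)
      (‖γ' t‖ ^ 2 + (conj (γ t) * γ'').re) t := by
    have hc : HasDerivAt (fun s => conj (γ s)) (conj (γ' t)) t := by
      exact Complex.conjCLE.toContinuousLinearMap.hasFDerivAt.comp_hasDerivAt t h
    have := Complex.reCLM.hasFDerivAt.comp_hasDerivAt t (hc.mul h')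
    convert! this using 1
    simp [Complex.conj_mul']
    norm_cast
  by_cases h0 : γ t = 0
  · have hO : (fun s => (conj (γ s) * γ' s).re) =O[𝓝 t] fun s => s - t := by
      simpa [h0] using hR.isBigO_sub
    have ho : (fun s => p * ‖γ s‖ ^ (p - 2)) =o[𝓝 t] fun _ => (1 : ℝ) := by
      rw [Asymptotics.isLittleO_one_iff]
      have := ((h.continuousAt.norm).rpow_const (p := p - 2) (Or.inr (by linarith))).const_mul p
      simpa [ContinuousAt, h0, Real.zero_rpow (by linarith : p - 2 ≠ 0)] using this
    have := ho.mul_isBigO hO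
    rw [hasDerivAt_iff_isLittleO]
    simpa [h0, Real.zero_rpow (by linarith : p - 2 ≠ 0)] using this
  · have hn : 0 < ‖γ t‖ := norm_pos_iff.2 h0
    have hN : HasDerivAt (fun s => ‖γ s‖ ^ (p - 2))
        ((p - 2) * ‖γ t‖ ^ (p - 4) * (conj (γ t) * γ' t).re) t := by
      have h2 := (h.norm_rpow_complex (p := 2) (by norm_num)).rpow_const (p := (p - 2) / 2)
        (Or.inl (by positivity))
      convert! h2 using 1
      · ext s
        rw [← Real.rpow_mul (norm_nonneg _)]
        congr 1; ring
      · simp only [sub_self, Real.rpow_zero]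
        rw [← Real.rpow_mul (norm_nonneg _)]
        have : 2 * ((p - 2) / 2 - 1) = p - 4 := by ring
        rw [this]; ring
    convert! (hN.const_mul p).mul hR using 1
    ring

/-- The left half-plane. -/
def leftHalfPlane : Set ℂ := {ζ | ζ.re < 0}

lemma continuousOn_vertical {E : Type*} [TopologicalSpace E] {Φ : ℂ → E}
    (hΦ : ContinuousOn Φ leftHalfPlane)
    {s : ℝ} (hs : s < 0) : Continuous fun θ : ℝ => Φ (s + θ * Complex.I) :=
  hΦ.comp_continuous (by fun_prop) fun θ => by simp [leftHalfPlane, hs]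

lemma hasDerivAt_integral_vertical {Φ Φ' C : ℂ → ℝ} (hΦ : ContinuousOn Φ leftHalfPlane)
    (hC : ContinuousOn C leftHalfPlane) (hle : ∀ ζ ∈ leftHalfPlane, |Φ' ζ| ≤ C ζ)
    (hd : ∀ s : ℝ, s < 0 → ∀ θ : ℝ, HasDerivAt (fun s : ℝ => Φ (s + θ * Complex.I))
      (Φ' (s + θ * Complex.I)) s)
    (hm : ∀ s : ℝ, s < 0 → Measurable fun θ : ℝ => Φ' (s + θ * Complex.I)) {s : ℝ} (hs : s < 0) :
    HasDerivAt (fun s : ℝ => ∫ θ in (-Real.pi)..Real.pi, Φ (s + θ * Complex.I))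
      (∫ θ in (-Real.pi)..Real.pi, Φ' (s + θ * Complex.I)) s := by
  have hK : IsCompact (Icc (2 * s) (s / 2) ×ˢ Icc (-Real.pi) Real.pi) :=
    isCompact_Icc.prod isCompact_Icc
  have hCc : ContinuousOn (fun q : ℝ × ℝ => C (q.1 + q.2 * Complex.I))
      (Icc (2 * s) (s / 2) ×ˢ Icc (-Real.pi) Real.pi) := by
    refine hC.comp (by fun_prop) fun q hq => ?_
    have : q.1 ≤ s / 2 := hq.1.2
    simp [leftHalfPlane]; linarith
  obtain ⟨M, hM⟩ := hK.exists_bound_of_continuousOn hCc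
  have hnhds : Icc (2 * s) (s / 2) ∈ 𝓝 s := Icc_mem_nhds (by linarith) (by linarith)
  have hpi : -Real.pi ≤ Real.pi := by linarith [Real.pi_pos]
  refine (intervalIntegral.hasDerivAt_integral_of_dominated_loc_of_deriv_le
    (F := fun (s θ : ℝ) => Φ (s + θ * Complex.I)) (F' := fun (s θ : ℝ) => Φ' (s + θ * Complex.I))
    (bound := fun _ => M) hnhds ?_ ?_ ?_ ?_ ?_ ?_).2
  · filter_upwards [Iio_mem_nhds hs] with x hx
    exact (continuousOn_vertical hΦ hx).aestronglyMeasurable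
  · exact (continuousOn_vertical hΦ hs).intervalIntegrable _ _
  · exact (hm s hs).aestronglyMeasurable
  · refine ae_of_all _ fun θ hθ x hx => ?_
    rw [uIoc_of_le hpi] at hθ
    have hx' : (x + θ * Complex.I : ℂ) ∈ leftHalfPlane := by
      have := hx.2
      simp [leftHalfPlane]; linarith
    have := hM (x, θ) ⟨hx, Ioc_subset_Icc_self hθ⟩
    exact (hle _ hx').trans ((le_abs_self _).trans this)
  · exact intervalIntegrable_const
  · refine ae_of_all _ fun θ _ x hx => hd x ?_ θ
    have := hx.2
    linarith

open ComplexConjugate in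
/-- Circular means of `‖h‖ ^ p` in logarithmic coordinates: first and second derivative. -/
lemma hasDerivAt_integral_norm_rpow {h h1 h2 : ℂ → ℂ} {p : ℝ} (hp : 2 < p)
    (hd : ∀ ζ ∈ leftHalfPlane, HasDerivAt h (h1 ζ) ζ)
    (hd1 : ∀ ζ ∈ leftHalfPlane, HasDerivAt h1 (h2 ζ) ζ)
    (hc2 : ContinuousOn h2 leftHalfPlane)
    (hper : ∀ ζ, h (ζ + 2 * Real.pi * Complex.I) = h ζ)
    (hper1 : ∀ ζ, h1 (ζ + 2 * Real.pi * Complex.I) = h1 ζ) {s : ℝ} (hs : s < 0) :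
    HasDerivAt (fun s : ℝ => ∫ θ in (-Real.pi)..Real.pi, ‖h (s + θ * Complex.I)‖ ^ p)
      (∫ θ in (-Real.pi)..Real.pi, p * ‖h (s + θ * Complex.I)‖ ^ (p - 2) *
        (conj (h (s + θ * Complex.I)) * h1 (s + θ * Complex.I)).re) s ∧
    HasDerivAt (fun s : ℝ => ∫ θ in (-Real.pi)..Real.pi, p * ‖h (s + θ * Complex.I)‖ ^ (p - 2) *
        (conj (h (s + θ * Complex.I)) * h1 (s + θ * Complex.I)).re)
      (∫ θ in (-Real.pi)..Real.pi, p ^ 2 * (‖h1 (s + θ * Complex.I)‖ ^ 2 *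
        ‖h (s + θ * Complex.I)‖ ^ (p - 2))) s := by
  have hc : ContinuousOn h leftHalfPlane := fun ζ hζ => (hd ζ hζ).continuousAt.continuousWithinAt
  have hc1 : ContinuousOn h1 leftHalfPlane := fun ζ hζ =>
    (hd1 ζ hζ).continuousAt.continuousWithinAt
  have hcr : ∀ q : ℝ, 0 ≤ q → ContinuousOn (fun ζ => ‖h ζ‖ ^ q) leftHalfPlane := fun q hq =>
    hc.norm.rpow_const fun _ _ => Or.inr hq
  have hcre : ∀ {u v : ℂ → ℂ}, ContinuousOn u leftHalfPlane → ContinuousOn v leftHalfPlane →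
      ContinuousOn (fun ζ => (conj (u ζ) * v ζ).re) leftHalfPlane := fun hu hv =>
    Complex.continuous_re.comp_continuousOn ((Complex.continuous_conj.comp_continuousOn hu).mul hv)
  have hre : ∀ a b : ℂ, |(conj a * b).re| ≤ ‖a‖ * ‖b‖ := fun a b => by
    simpa using Complex.abs_re_le_norm (conj a * b)
  have hline : ∀ (s θ : ℝ), HasDerivAt (fun s : ℝ => (s + θ * Complex.I : ℂ)) 1 s := fun s θ =>
    (Complex.ofRealCLM.hasDerivAt (x := s)).add_const _
  have hline' : ∀ (s θ : ℝ), HasDerivAt (fun θ : ℝ => (s + θ * Complex.I : ℂ)) Complex.I θ :=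
    fun s θ => by
      simpa using (((Complex.ofRealCLM.hasDerivAt (x := θ)).mul_const Complex.I).const_add (s : ℂ))
  have hmem : ∀ s : ℝ, s < 0 → ∀ θ : ℝ, (s + θ * Complex.I : ℂ) ∈ leftHalfPlane := fun s hs θ => by
    simp [leftHalfPlane, hs]
  constructor
  · refine hasDerivAt_integral_vertical
      (Φ' := fun ζ => p * ‖h ζ‖ ^ (p - 2) * (conj (h ζ) * h1 ζ).re)
      (C := fun ζ => |p * ‖h ζ‖ ^ (p - 2) * (conj (h ζ) * h1 ζ).re|)
      (hcr p (by linarith)) ?_ (fun _ _ => le_rfl) ?_ ?_ hs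
    · exact (((hcr _ (by linarith)).const_mul p).mul (hcre hc hc1)).abs
    · intro s hs θ
      have := (hd _ (hmem s hs θ)).scomp s (hline s θ)
      simp only [one_smul] at this
      exact this.norm_rpow_complex (by linarith)
    · intro s hs
      exact (continuousOn_vertical (((hcr _ (by linarith)).const_mul p).mul (hcre hc hc1))
        hs).measurable
  · set D : (ℂ → ℂ) → (ℂ → ℂ) → ℂ → ℝ := fun k1 k2 ζ =>
      p * ((p - 2) * ‖h ζ‖ ^ (p - 4) * (conj (h ζ) * k1 ζ).re ^ 2 +
        ‖h ζ‖ ^ (p - 2) * (‖k1 ζ‖ ^ 2 + (conj (h ζ) * k2 ζ).re)) with hD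
    set C : ℂ → ℝ := fun ζ => p * ((p - 2) * (‖h ζ‖ ^ (p - 2) * ‖h1 ζ‖ ^ 2) +
        ‖h ζ‖ ^ (p - 2) * (‖h1 ζ‖ ^ 2 + ‖h ζ‖ * ‖h2 ζ‖)) with hCdef
    have hpow : ∀ ζ, ‖h ζ‖ ^ (p - 4) * ‖h ζ‖ ^ 2 = ‖h ζ‖ ^ (p - 2) := fun ζ => by
      rcases (norm_nonneg (h ζ)).eq_or_lt with h0 | h0
      · rw [← h0, Real.zero_rpow (by linarith : p - 2 ≠ 0)]; simp
      · rw [← Real.rpow_natCast, ← Real.rpow_add h0]; congr 1; push_cast; ring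
    have hbound : ∀ k1 k2 : ℂ → ℂ, (∀ ζ, ‖k1 ζ‖ = ‖h1 ζ‖) → (∀ ζ, ‖k2 ζ‖ = ‖h2 ζ‖) →
        ∀ ζ, |D k1 k2 ζ| ≤ C ζ := by
      intro k1 k2 e1 e2 ζ
      have a1 : (conj (h ζ) * k1 ζ).re ^ 2 ≤ ‖h ζ‖ ^ 2 * ‖h1 ζ‖ ^ 2 := by
        rw [← mul_pow, ← e1, ← sq_abs]
        exact pow_le_pow_left₀ (abs_nonneg _) (hre _ _) 2
      have a2 : |(conj (h ζ) * k2 ζ).re| ≤ ‖h ζ‖ * ‖h2 ζ‖ := by rw [← e2]; exact hre _ _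
      simp only [hD, hCdef]
      rw [abs_mul, abs_of_pos (by linarith : 0 < p)]
      refine mul_le_mul_of_nonneg_left ?_ (by linarith)
      refine (abs_add_le _ _).trans (add_le_add ?_ ?_)
      · have hp2 : 0 ≤ p - 2 := by linarith
        rw [abs_of_nonneg (by positivity), ← hpow, mul_assoc, mul_assoc]
        gcongr
      · rw [abs_mul, abs_of_nonneg (by positivity)]
        gcongr
        refine (abs_add_le _ _).trans ?_
        rw [abs_of_nonneg (by positivity), e1]
        gcongr
    have hCc : ContinuousOn C leftHalfPlane := by
      have := hcr (p - 2) (by linarith)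
      have n1 := hc1.norm
      have n2 := hc2.norm
      have n0 := hc.norm
      fun_prop
    have hDm : ∀ k1 k2 : ℂ → ℂ, ContinuousOn k1 leftHalfPlane → ContinuousOn k2 leftHalfPlane →
        ∀ s : ℝ, s < 0 → Measurable fun θ : ℝ => D k1 k2 (s + θ * Complex.I) := by
      intro k1 k2 hk1 hk2 s hs
      have m0 := (continuousOn_vertical hc.norm hs).measurable
      have m1 := (continuousOn_vertical hk1.norm hs).measurable
      have m2 := (continuousOn_vertical (hcre hc hk1) hs).measurable
      have m3 := (continuousOn_vertical (hcre hc hk2) hs).measurable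
      exact ((((m0.pow_const _).const_mul _).mul (m2.pow_const 2)).add
        ((m0.pow_const _).mul ((m1.pow_const 2).add m3))).const_mul p
    have hsum : ∀ ζ, p ^ 2 * (‖h1 ζ‖ ^ 2 * ‖h ζ‖ ^ (p - 2)) =
        D h1 h2 ζ + D (fun ζ => Complex.I * h1 ζ) (fun ζ => -h2 ζ) ζ := by
      intro ζ
      have e : (conj (h ζ) * h1 ζ).re ^ 2 + (conj (h ζ) * (Complex.I * h1 ζ)).re ^ 2
          = ‖h ζ‖ ^ 2 * ‖h1 ζ‖ ^ 2 := by
        rw [← Complex.normSq_eq_norm_sq, ← Complex.normSq_eq_norm_sq]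
        simp [Complex.normSq_apply]
        ring
      have e2 : (conj (h ζ) * -h2 ζ).re = -(conj (h ζ) * h2 ζ).re := by simp
      simp only [hD, e2, norm_mul, Complex.norm_I, one_mul]
      linear_combination (-p * (p - 2) * ‖h ζ‖ ^ (p - 4)) * e
        + (-p * (p - 2) * ‖h1 ζ‖ ^ 2) * hpow ζ
    have hDd := hasDerivAt_integral_vertical (Φ' := D h1 h2) (C := C)
      (Φ := fun ζ => p * ‖h ζ‖ ^ (p - 2) * (conj (h ζ) * h1 ζ).re)
      (((hcr _ (by linarith)).const_mul p).mul (hcre hc hc1)) hCc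
      (fun ζ _ => hbound h1 h2 (fun _ => rfl) (fun _ => rfl) ζ)
      (fun s hs θ => by
        have g0 := (hd _ (hmem s hs θ)).scomp s (hline s θ)
        have g1 := (hd1 _ (hmem s hs θ)).scomp s (hline s θ)
        simp only [one_smul] at g0 g1
        exact HasDerivAt.norm_rpow_mul_re_complex hp g0 g1)
      (hDm h1 h2 hc1 hc2) hs
    have hkint : ∀ k1 k2 : ℂ → ℂ, (∀ ζ, ‖k1 ζ‖ = ‖h1 ζ‖) → (∀ ζ, ‖k2 ζ‖ = ‖h2 ζ‖) →
        ContinuousOn k1 leftHalfPlane → ContinuousOn k2 leftHalfPlane →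
        IntervalIntegrable (fun θ : ℝ => D k1 k2 (s + θ * Complex.I)) volume
          (-Real.pi) Real.pi := by
      intro k1 k2 e1 e2 c1 c2
      refine ((continuousOn_vertical hCc hs).intervalIntegrable _ _).mono_fun
        (hDm k1 k2 c1 c2 s hs).aestronglyMeasurable (ae_of_all _ fun θ => ?_)
      exact (hbound k1 k2 e1 e2 _).trans (le_abs_self _)
    have hcI : ContinuousOn (fun ζ => Complex.I * h1 ζ) leftHalfPlane := hc1.const_mul _
    have hi1 := hkint h1 h2 (fun _ => rfl) (fun _ => rfl) hc1 hc2
    have hi2 := hkint (fun ζ => Complex.I * h1 ζ) (fun ζ => -h2 ζ) (by simp) (by simp) hcI hc2.neg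
    have hzero : ∫ θ in (-Real.pi)..Real.pi,
        D (fun ζ => Complex.I * h1 ζ) (fun ζ => -h2 ζ) (s + θ * Complex.I) = 0 := by
      rw [intervalIntegral.integral_eq_sub_of_hasDerivAt (f := fun θ : ℝ =>
        p * ‖h (s + θ * Complex.I)‖ ^ (p - 2) *
          (conj (h (s + θ * Complex.I)) * (Complex.I * h1 (s + θ * Complex.I))).re) _ hi2]
      · have : (s + Real.pi * Complex.I : ℂ)
            = (s + (-Real.pi : ℝ) * Complex.I) + 2 * Real.pi * Complex.I := by
          push_cast; ring
        rw [this, hper, hper1, sub_self]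
      · intro θ _
        have g0 := (hd _ (hmem s hs θ)).scomp θ (hline' s θ)
        have g1 := ((hd1 _ (hmem s hs θ)).scomp θ (hline' s θ)).const_mul Complex.I
        have := HasDerivAt.norm_rpow_mul_re_complex hp g0 (γ' := fun θ : ℝ =>
          Complex.I * h1 (s + θ * Complex.I)) g1
        convert! this using 1
        have : Complex.I * Complex.I • h2 (s + θ * Complex.I) = -h2 (s + θ * Complex.I) := by
          rw [smul_eq_mul, ← mul_assoc, Complex.I_mul_I]; ring
        simp only [hD, this, Function.comp_apply]
    simp_rw [hsum]
    rw [intervalIntegral.integral_add hi1 hi2, hzero, add_zero]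
    exact hDd

lemma neg_pi_le_pi : -Real.pi ≤ Real.pi := by linarith [Real.pi_pos]

/-- Circular means converge to the value at the centre. -/
lemma tendsto_integral_circle_atBot {Ψ : ℂ → ℝ} (hΨ : ContinuousOn Ψ unitDisk) :
    Tendsto (fun s : ℝ => ∫ θ in (-Real.pi)..Real.pi, Ψ (Complex.exp (s + θ * Complex.I))) atBot
      (𝓝 (2 * Real.pi * Ψ 0)) := by
  have h0 : (0 : ℂ) ∈ unitDisk := by simp [unitDisk]
  have hK : IsCompact (Metric.closedBall (0 : ℂ) (1 / 2)) := isCompact_closedBall _ _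
  have hsub : Metric.closedBall (0 : ℂ) (1 / 2) ⊆ unitDisk :=
    Metric.closedBall_subset_ball (by norm_num)
  obtain ⟨M, hM⟩ := hK.exists_bound_of_continuousOn (hΨ.mono hsub)
  have hlim : ∫ _ in (-Real.pi)..Real.pi, Ψ 0 = 2 * Real.pi * Ψ 0 := by
    rw [intervalIntegral.integral_const, smul_eq_mul]; ring
  rw [← hlim]
  refine intervalIntegral.tendsto_integral_filter_of_dominated_convergence (fun _ => M) ?_ ?_
    intervalIntegrable_const ?_
  · filter_upwards [Iio_mem_atBot (0 : ℝ)] with s hs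
    refine Continuous.aestronglyMeasurable ?_
    exact hΨ.comp_continuous (by fun_prop) fun θ => exp_add_mul_I_mem_unitDisk hs θ
  · filter_upwards [Iio_mem_atBot (Real.log (1 / 2))] with s hs
    refine ae_of_all _ fun θ _ => hM _ ?_
    rw [mem_closedBall_zero_iff, norm_exp_add_mul_I]
    exact ((Real.lt_log_iff_exp_lt (by norm_num)).1 hs).le
  · refine ae_of_all _ fun θ _ => ?_
    refine ((hΨ.continuousAt (Metric.isOpen_ball.mem_nhds h0)).tendsto).comp ?_
    rw [tendsto_zero_iff_norm_tendsto_zero]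
    simp only [norm_exp_add_mul_I]
    exact Real.tendsto_exp_atBot

lemma lintegral_circle_ofReal {Φ : ℂ → ℝ} (hΦ : ContinuousOn Φ unitDisk) (h0 : ∀ z, 0 ≤ Φ z)
    {s : ℝ} (hs : s < 0) :
    ∫⁻ θ in Ioc (-Real.pi) Real.pi, ENNReal.ofReal (Φ (Complex.exp (s + θ * Complex.I))) =
      ENNReal.ofReal (∫ θ in (-Real.pi)..Real.pi, Φ (Complex.exp (s + θ * Complex.I))) := by
  have hc : Continuous fun θ : ℝ => Φ (Complex.exp (s + θ * Complex.I)) :=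
    hΦ.comp_continuous (by fun_prop) fun θ => exp_add_mul_I_mem_unitDisk hs θ
  rw [intervalIntegral.integral_of_le neg_pi_le_pi, ofReal_integral_eq_lintegral_ofReal]
  · exact hc.integrableOn_Ioc
  · exact ae_of_all _ fun θ => h0 _

lemma lintegral_Iio_of_hasDerivAt_Iio {m m1 : ℝ → ℝ} {L : ℝ}
    (hd : ∀ s < 0, HasDerivAt m (m1 s) s) (h0 : ∀ s < 0, 0 ≤ m1 s)
    (hL : Tendsto m atBot (𝓝 L)) {t : ℝ} (ht : t < 0) :
    L ≤ m t ∧ ∫⁻ s in Iio t, ENNReal.ofReal (m1 s) = ENNReal.ofReal (m t - L) := by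
  have hc : ContinuousOn m (Iio 0) := fun s hs => (hd s hs).continuousAt.continuousWithinAt
  constructor
  · have hmono : MonotoneOn m (Iio 0) := by
      refine monotoneOn_of_deriv_nonneg (convex_Iio 0) hc ?_ ?_
      · rw [interior_Iio]
        exact fun s hs => (hd s hs).differentiableAt.differentiableWithinAt
      · rw [interior_Iio]
        exact fun s hs => by rw [(hd s hs).deriv]; exact h0 s hs
    refine le_of_tendsto hL ?_
    filter_upwards [Iic_mem_atBot t] with s hs
    exact hmono (lt_of_le_of_lt hs ht) ht hs
  · exact lintegral_Iio_of_hasDerivAt_of_nonneg (hc.mono fun s hs => lt_of_le_of_lt hs ht)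
      (fun s hs => hd s (hs.trans ht)) (fun s hs => h0 s (hs.trans ht)) hL

/-- The tail `∫_s^0 (1 - e^{2τ})^{b} dτ`. -/
def radialTail (b s : ℝ) : ℝ≥0∞ :=
  ∫⁻ τ in Ioo s 0, ENNReal.ofReal ((1 - Real.exp (2 * τ)) ^ b)

lemma antitone_radialTail (b : ℝ) : Antitone (radialTail b) := fun _ _ h =>
  lintegral_mono_set (Ioo_subset_Ioo_left h)

lemma hasDerivAt_one_sub_exp_rpow (b : ℝ) {t : ℝ} (ht : t < 0) :
    HasDerivAt (fun t => -(1 - Real.exp (2 * t)) ^ (b + 1))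
      (2 * (b + 1) * (Real.exp (2 * t) * (1 - Real.exp (2 * t)) ^ b)) t := by
  have hpos : 0 < 1 - Real.exp (2 * t) := by
    rw [sub_pos, Real.exp_lt_one_iff]; linarith
  have h1 : HasDerivAt (fun t : ℝ => 1 - Real.exp (2 * t)) (-(Real.exp (2 * t) * 2)) t := by
    have := (((hasDerivAt_id t).const_mul 2).exp).const_sub 1
    simpa using this
  convert! (h1.rpow_const (p := b + 1) (Or.inl hpos.ne')).neg using 1
  rw [add_sub_cancel_right]
  ring

lemma continuous_one_sub_exp_rpow {b : ℝ} (hb : -1 < b) :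
    Continuous (fun t : ℝ => -(1 - Real.exp (2 * t)) ^ (b + 1)) := by
  refine (Continuous.rpow_const (by fun_prop) fun _ => Or.inr (by linarith)).neg

lemma one_sub_exp_pos {t : ℝ} (ht : t < 0) : 0 < 1 - Real.exp (2 * t) := by
  rw [sub_pos, Real.exp_lt_one_iff]; linarith

lemma lintegral_Ioo_radialWeight {b : ℝ} (hb : -1 < b) {s : ℝ} (hs : s < 0) :
    ∫⁻ t in Ioo s 0, ENNReal.ofReal (Real.exp (2 * t) * (1 - Real.exp (2 * t)) ^ b) =
      ENNReal.ofReal (1 / (2 * (b + 1))) * ENNReal.ofReal ((1 - Real.exp (2 * s)) ^ (b + 1)) := by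
  have hb1 : 0 < b + 1 := by linarith
  have h := lintegral_Ioc_of_hasDerivAt_of_nonneg hs.le
    (continuous_one_sub_exp_rpow hb).continuousOn
    (fun t ht => hasDerivAt_one_sub_exp_rpow b ht.2)
    (fun t ht => by have := one_sub_exp_pos ht.2; positivity)
  rw [restrict_Ioo_eq_restrict_Ioc]
  simp_rw [ENNReal.ofReal_mul (by positivity : 0 ≤ 2 * (b + 1))] at h
  rw [lintegral_const_mul' _ _ ENNReal.ofReal_ne_top] at h
  have h2 : -(1 - Real.exp (2 * 0)) ^ (b + 1) - -(1 - Real.exp (2 * s)) ^ (b + 1)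
      = (1 - Real.exp (2 * s)) ^ (b + 1) := by
    simp [Real.zero_rpow hb1.ne']
  rw [h2] at h
  rw [← h, ← mul_assoc, ← ENNReal.ofReal_mul (by positivity)]
  rw [show 1 / (2 * (b + 1)) * (2 * (b + 1)) = 1 by field_simp]
  simp

lemma lintegral_Iio_radialWeight {b : ℝ} (hb : -1 < b) :
    ∫⁻ t in Iio (0 : ℝ), ENNReal.ofReal (Real.exp (2 * t) * (1 - Real.exp (2 * t)) ^ b) =
      ENNReal.ofReal (1 / (2 * (b + 1))) := by
  have hb1 : 0 < b + 1 := by linarith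
  have hexp : Tendsto (fun t : ℝ => Real.exp (2 * t)) atBot (𝓝 0) :=
    Real.tendsto_exp_atBot.comp (tendsto_id.const_mul_atBot (by norm_num))
  have hlim : Tendsto (fun t : ℝ => -(1 - Real.exp (2 * t)) ^ (b + 1)) atBot (𝓝 (-1)) := by
    have := ((hexp.const_sub 1).rpow_const (p := b + 1) (Or.inr hb1.le)).neg
    simpa using this
  have h := lintegral_Iio_of_hasDerivAt_of_nonneg
    (continuous_one_sub_exp_rpow hb).continuousOn
    (fun t ht => hasDerivAt_one_sub_exp_rpow b ht)
    (fun t ht => by have := one_sub_exp_pos ht; positivity) hlim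
  simp_rw [ENNReal.ofReal_mul (by positivity : 0 ≤ 2 * (b + 1))] at h
  rw [lintegral_const_mul' _ _ ENNReal.ofReal_ne_top] at h
  have h2 : -(1 - Real.exp (2 * 0)) ^ (b + 1) - -1 = 1 := by
    simp [Real.zero_rpow hb1.ne']
  rw [h2] at h
  have h3 := congrArg (fun x => ENNReal.ofReal (1 / (2 * (b + 1))) * x) h
  beta_reduce at h3
  rw [← mul_assoc, ← ENNReal.ofReal_mul (by positivity),
    show 1 / (2 * (b + 1)) * (2 * (b + 1)) = 1 by field_simp] at h3
  simpa using h3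

lemma measurable_radialWeight (b : ℝ) :
    Measurable fun t : ℝ => ENNReal.ofReal (Real.exp (2 * t) * (1 - Real.exp (2 * t)) ^ b) := by
  fun_prop

open ComplexConjugate in
/-- **Hardy–Stein identity** for standard weighted Bergman norms. -/
theorem ApIntPow_eq_hardyStein {p β : ℝ} (hp : 2 < p) (hβ : -1 < β) {f : ℂ → ℂ}
    (hf : DifferentiableOn ℂ f unitDisk) :
    ApIntPow p β f = ENNReal.ofReal (‖f 0‖ ^ p) + ENNReal.ofReal (p ^ 2 / (2 * Real.pi)) *
      ∫⁻ z in unitDisk, ENNReal.ofReal (‖deriv f z‖ ^ 2 * ‖f z‖ ^ (p - 2)) *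
        radialTail (β + 1) (Real.log ‖z‖) := by
  have hopen : IsOpen unitDisk := Metric.isOpen_ball
  have hf' : DifferentiableOn ℂ (deriv f) unitDisk := hf.deriv hopen
  have hf'' : DifferentiableOn ℂ (deriv (deriv f)) unitDisk := hf'.deriv hopen
  have hexpmem : ∀ ζ ∈ leftHalfPlane, Complex.exp ζ ∈ unitDisk := fun ζ hζ => by
    simpa [unitDisk, Complex.norm_exp, leftHalfPlane] using hζ
  have hmaps : MapsTo Complex.exp leftHalfPlane unitDisk := hexpmem
  set h : ℂ → ℂ := fun ζ => f (Complex.exp ζ) with hh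
  set h1 : ℂ → ℂ := fun ζ => deriv f (Complex.exp ζ) * Complex.exp ζ with hh1
  set h2 : ℂ → ℂ := fun ζ => deriv (deriv f) (Complex.exp ζ) * Complex.exp ζ * Complex.exp ζ +
    deriv f (Complex.exp ζ) * Complex.exp ζ with hh2
  have hd : ∀ ζ ∈ leftHalfPlane, HasDerivAt h (h1 ζ) ζ := fun ζ hζ =>
    ((hf.differentiableAt (hopen.mem_nhds (hexpmem ζ hζ))).hasDerivAt).comp ζ
      (Complex.hasDerivAt_exp ζ)
  have hd1 : ∀ ζ ∈ leftHalfPlane, HasDerivAt h1 (h2 ζ) ζ := fun ζ hζ =>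
    (((hf'.differentiableAt (hopen.mem_nhds (hexpmem ζ hζ))).hasDerivAt).comp ζ
      (Complex.hasDerivAt_exp ζ)).mul (Complex.hasDerivAt_exp ζ)
  have hc2 : ContinuousOn h2 leftHalfPlane := by
    have e := Complex.continuous_exp.continuousOn (s := leftHalfPlane)
    exact (((hf''.continuousOn.comp e hmaps).mul e).mul e).add
      ((hf'.continuousOn.comp e hmaps).mul e)
  have hper : ∀ ζ, h (ζ + 2 * Real.pi * Complex.I) = h ζ := fun ζ => by
    simp only [hh, Complex.exp_periodic ζ]
  have hper1 : ∀ ζ, h1 (ζ + 2 * Real.pi * Complex.I) = h1 ζ := fun ζ => by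
    simp only [hh1, Complex.exp_periodic ζ]
  have hder := fun {s : ℝ} (hs : s < 0) =>
    hasDerivAt_integral_norm_rpow hp hd hd1 hc2 hper hper1 hs
  set m : ℝ → ℝ := fun s => ∫ θ in (-Real.pi)..Real.pi, ‖h (s + θ * Complex.I)‖ ^ p with hm
  set m1 : ℝ → ℝ := fun s => ∫ θ in (-Real.pi)..Real.pi, p * ‖h (s + θ * Complex.I)‖ ^ (p - 2) *
        (conj (h (s + θ * Complex.I)) * h1 (s + θ * Complex.I)).re with hm1
  set m2 : ℝ → ℝ := fun s => ∫ θ in (-Real.pi)..Real.pi, p ^ 2 * (‖h1 (s + θ * Complex.I)‖ ^ 2 *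
        ‖h (s + θ * Complex.I)‖ ^ (p - 2)) with hm2
  have hpc : ∀ q : ℝ, 0 ≤ q → ContinuousOn (fun z => ‖f z‖ ^ q) unitDisk := fun q hq =>
    hf.continuousOn.norm.rpow_const fun _ _ => Or.inr hq
  have hmlim : Tendsto m atBot (𝓝 (2 * Real.pi * ‖f 0‖ ^ p)) :=
    tendsto_integral_circle_atBot (hpc p (by linarith))
  have hm1lim : Tendsto m1 atBot (𝓝 0) := by
    have := tendsto_integral_circle_atBot (Ψ := fun z => p * ‖f z‖ ^ (p - 2) *
        (conj (f z) * (deriv f z * z)).re) (((hpc _ (by linarith)).const_mul p).mul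
        (Complex.continuous_re.comp_continuousOn
          ((Complex.continuous_conj.comp_continuousOn hf.continuousOn).mul
            (hf'.continuousOn.mul continuousOn_id))))
    have h0 : 2 * Real.pi * (p * ‖f 0‖ ^ (p - 2) * (conj (f 0) * (deriv f 0 * 0)).re) = 0 := by
      simp
    rw [← h0]
    exact this
  have hm2nn : ∀ s, 0 ≤ m2 s := fun s => by
    refine intervalIntegral.integral_nonneg neg_pi_le_pi fun θ _ => ?_
    positivity
  have e1 := fun {t : ℝ} (ht : t < 0) => lintegral_Iio_of_hasDerivAt_Iio
    (fun s hs => (hder hs).2) (fun s _ => hm2nn s) hm1lim ht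
  have e0 := fun {t : ℝ} (ht : t < 0) => lintegral_Iio_of_hasDerivAt_Iio
    (fun s hs => (hder hs).1) (fun s hs => (e1 hs).1) hmlim ht
  have hm1meas : AEMeasurable (fun s => ENNReal.ofReal (m1 s)) (volume.restrict (Iio 0)) := by
    refine ENNReal.measurable_ofReal.comp_aemeasurable (ContinuousOn.aemeasurable ?_
      measurableSet_Iio)
    exact fun s hs => (hder hs).2.continuousAt.continuousWithinAt
  have hm2meas : AEMeasurable (fun s => ENNReal.ofReal (m2 s)) (volume.restrict (Iio 0)) := by
    refine ENNReal.measurable_ofReal.comp_aemeasurable ?_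
    have : AEMeasurable (deriv m1) (volume.restrict (Iio 0)) := (measurable_deriv m1).aemeasurable
    refine this.congr ?_
    filter_upwards [ae_restrict_mem measurableSet_Iio] with s hs using (hder hs).2.deriv
  set W : ℝ → ℝ≥0∞ := fun t => ENNReal.ofReal (Real.exp (2 * t) * (1 - Real.exp (2 * t)) ^ β)
    with hW
  have hWm : Measurable W := measurable_radialWeight β
  set c : ℝ≥0∞ := ENNReal.ofReal (1 / (2 * (β + 1))) with hc
  have hβ1 : 0 < β + 1 := by linarith
  -- the left-hand side
  have hL : ∫⁻ z in unitDisk, ENNReal.ofReal ((1 - ‖z‖ ^ 2) ^ β * ‖f z‖ ^ p) =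
      ∫⁻ t in Iio (0 : ℝ), W t * ENNReal.ofReal (m t) := by
    rw [lintegral_unitDisk_eq]
    · refine setLIntegral_congr_fun measurableSet_Iio fun t ht => ?_
      have hpos := one_sub_exp_pos ht
      have : ∀ θ : ℝ, ENNReal.ofReal ((1 - ‖Complex.exp (t + θ * Complex.I)‖ ^ 2) ^ β *
          ‖f (Complex.exp (t + θ * Complex.I))‖ ^ p) =
          ENNReal.ofReal ((1 - Real.exp (2 * t)) ^ β) *
          ENNReal.ofReal (‖f (Complex.exp (t + θ * Complex.I))‖ ^ p) := fun θ => by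
        rw [norm_exp_add_mul_I, ← Real.exp_nat_mul, ENNReal.ofReal_mul]
        · norm_cast
        · push_cast; positivity
      simp only [this]
      rw [lintegral_const_mul' _ _ ENNReal.ofReal_ne_top,
        lintegral_circle_ofReal (hpc p (by linarith)) (fun z => by positivity) ht, ← mul_assoc,
        ← ENNReal.ofReal_mul (Real.exp_pos _).le]
    · refine measurable_indicator_of_continuousOn measurableSet_unitDisk
        (ENNReal.continuous_ofReal.comp_continuousOn (ContinuousOn.mul ?_ (hpc p (by linarith))))
      refine ContinuousOn.rpow_const (by fun_prop) fun z hz => Or.inl ?_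
      have : ‖z‖ < 1 := by simpa [unitDisk] using hz
      nlinarith [norm_nonneg z]
  -- the right-hand side
  have hR : ENNReal.ofReal (p ^ 2) * ∫⁻ z in unitDisk,
      ENNReal.ofReal (‖deriv f z‖ ^ 2 * ‖f z‖ ^ (p - 2)) *
        radialTail (β + 1) (Real.log ‖z‖) =
      ∫⁻ s in Iio (0 : ℝ), ENNReal.ofReal (m2 s) * radialTail (β + 1) s := by
    have hcont : ContinuousOn (fun z => ‖deriv f z‖ ^ 2 * ‖f z‖ ^ (p - 2)) unitDisk :=
      (hf'.continuousOn.norm.pow 2).mul (hpc _ (by linarith))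
    rw [lintegral_unitDisk_eq]
    · rw [← lintegral_const_mul' _ _ ENNReal.ofReal_ne_top]
      refine setLIntegral_congr_fun measurableSet_Iio fun s hs => ?_
      simp only [norm_exp_add_mul_I, Real.log_exp]
      rw [lintegral_mul_const'', lintegral_circle_ofReal hcont (fun z => by positivity) hs,
        ← mul_assoc, ← mul_assoc, ← ENNReal.ofReal_mul (by positivity),
        ← ENNReal.ofReal_mul (by positivity)]
      · congr 2
        simp only [hm2]
        rw [← intervalIntegral.integral_const_mul]
        refine intervalIntegral.integral_congr fun θ _ => ?_
        simp only [hh1, hh, norm_mul, norm_exp_add_mul_I]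
        rw [two_mul, Real.exp_add]
        ring
      · refine (Continuous.measurable ?_).aemeasurable
        exact ENNReal.continuous_ofReal.comp (hcont.comp_continuous (by fun_prop)
          fun θ => exp_add_mul_I_mem_unitDisk hs θ)
    · rw [indicator_mul]
      refine Measurable.mul ?_ ?_
      · exact measurable_indicator_of_continuousOn measurableSet_unitDisk
          (ENNReal.continuous_ofReal.comp_continuousOn hcont)
      · exact ((antitone_radialTail _).measurable.comp
          (Real.measurable_log.comp measurable_norm)).indicator measurableSet_unitDisk
  have hmain : ∫⁻ t in Iio (0 : ℝ), W t * ENNReal.ofReal (m t) =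
      c * (ENNReal.ofReal (2 * Real.pi * ‖f 0‖ ^ p) +
        ∫⁻ s in Iio (0 : ℝ), ENNReal.ofReal (m2 s) * radialTail (β + 1) s) := by
    have s1 : ∀ t ∈ Iio (0 : ℝ), W t * ENNReal.ofReal (m t) =
        W t * ENNReal.ofReal (2 * Real.pi * ‖f 0‖ ^ p) +
          W t * ∫⁻ s in Iio t, ENNReal.ofReal (m1 s) := fun t ht => by
      rw [(e0 ht).2, ← mul_add, ← ENNReal.ofReal_add (by positivity)
        (sub_nonneg.2 (e0 ht).1), add_sub_cancel]
    rw [setLIntegral_congr_fun measurableSet_Iio s1, lintegral_add_left (by fun_prop),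
      lintegral_mul_const _ hWm, lintegral_Iio_radialWeight hβ, ← hc, mul_add c]
    congr 1
    rw [lintegral_Iio_triangle_swap hWm hm1meas]
    have s2 : ∀ s ∈ Iio (0 : ℝ), ENNReal.ofReal (m1 s) * ∫⁻ t in Ioo s 0, W t =
        c * (ENNReal.ofReal ((1 - Real.exp (2 * s)) ^ (β + 1)) *
          ∫⁻ r in Iio s, ENNReal.ofReal (m2 r)) := fun s hs => by
      rw [lintegral_Ioo_radialWeight hβ hs, (e1 hs).2, sub_zero]
      ring
    rw [setLIntegral_congr_fun measurableSet_Iio s2,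
      lintegral_const_mul' _ _ ENNReal.ofReal_ne_top,
      lintegral_Iio_triangle_swap (by fun_prop) hm2meas]
    rfl
  have hpi := Real.pi_pos
  rw [ApIntPow, hL, hmain, ← hR, ENNReal.div_eq_inv_mul, ← ENNReal.ofReal_inv_of_pos hpi]
  simp only [mul_add (ENNReal.ofReal _), mul_add c, ← mul_assoc]
  rw [hc]
  rw [← ENNReal.ofReal_mul (by positivity), ← ENNReal.ofReal_mul (by positivity),
    ← ENNReal.ofReal_mul (by positivity), ← ENNReal.ofReal_mul (by positivity)]
  congr 2
  · field_simp
  · congr 1; field_simp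

lemma norm_lt_one_of_mem_unitDisk {z : ℂ} (hz : z ∈ unitDisk) : ‖z‖ < 1 := by
  simpa [unitDisk] using hz

lemma one_sub_norm_sq_pos {z : ℂ} (hz : z ∈ unitDisk) : 0 < 1 - ‖z‖ ^ 2 := by
  have := norm_lt_one_of_mem_unitDisk hz
  nlinarith [norm_nonneg z]

lemma one_div_le_Hinner {α : ℝ} (hα : -1 ≤ α) {z : ℂ} (hz : z ∈ unitDisk) :
    ENNReal.ofReal (1 / (α + 2)) ≤ Hinner α z := by
  have hx := one_sub_norm_sq_pos hz
  have ha : 0 < α + 2 := by linarith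
  have h := lintegral_Ioc_of_hasDerivAt_of_nonneg (g := fun s => s ^ (α + 2) / (α + 2))
    (g' := fun s => s ^ (α + 1)) (zero_le_one (α := ℝ))
    (((continuous_id.rpow_const fun _ => Or.inr ha.le).div_const _).continuousOn)
    (fun t ht => by
      have := (Real.hasDerivAt_rpow_const (p := α + 2) (Or.inl ht.1.ne')).div_const (α + 2)
      convert! this using 1
      rw [mul_div_cancel_left₀ _ ha.ne']
      ring_nf)
    (fun t ht => by have := ht.1; positivity)
  rw [← restrict_Ioo_eq_restrict_Ioc] at h
  have e : (1 : ℝ) / (α + 2) = 1 ^ (α + 2) / (α + 2) - 0 ^ (α + 2) / (α + 2) := by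
    rw [Real.one_rpow, Real.zero_rpow ha.ne']; ring
  rw [e, ← h, Hinner]
  refine setLIntegral_mono' measurableSet_Ioo fun s hs => ENNReal.ofReal_le_ofReal ?_
  have h1 : 0 < 1 - (1 - ‖z‖ ^ 2) * s := by nlinarith [hs.1, hs.2, sq_nonneg ‖z‖]
  rw [le_div_iff₀ h1]
  have h2 : 0 ≤ s ^ (α + 1) := Real.rpow_nonneg hs.1.le _
  have h3 : 0 ≤ (1 - ‖z‖ ^ 2) * s := mul_nonneg hx.le hs.1.le
  nlinarith

theorem Gfun_le_Ffun {α p : ℝ} (hα : -1 ≤ α) (hp : 2 < p) (f : ℂ → ℂ) :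
    Gfun α p f ≤ Ffun α p f := by
  have ha : 0 < α + 2 := by linarith
  have hp0 : 0 < p := by linarith
  refine le_trans ?_ le_add_self
  rw [Gfun]
  refine ENNReal.div_le_div_right ?_ _
  have e : p / (2 * (α + 2)) = p / 2 * (1 / (α + 2)) := by field_simp
  rw [e, ENNReal.ofReal_mul (by positivity), mul_assoc,
    ← lintegral_const_mul' _ _ ENNReal.ofReal_ne_top]
  refine mul_le_mul' le_rfl ?_
  refine setLIntegral_mono' measurableSet_unitDisk fun z hz => ?_
  rw [mul_comm]
  gcongr
  exact one_div_le_Hinner hα hz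

/-- The substitution `σ = ((1 - e^{2τ}) / (1 - e^{2s}))^{q}`. -/
lemma lintegral_Ioo_zero_one_eq_radial {q s : ℝ} (hq : 0 < q) (hs : s < 0) (F : ℝ → ℝ≥0∞) :
    ∫⁻ σ in Ioo (0 : ℝ) 1, F σ = ∫⁻ τ in Ioo s 0,
      ENNReal.ofReal (q * ((1 - Real.exp (2 * τ)) / (1 - Real.exp (2 * s))) ^ (q - 1) *
        (2 * Real.exp (2 * τ) / (1 - Real.exp (2 * s)))) *
      F (((1 - Real.exp (2 * τ)) / (1 - Real.exp (2 * s))) ^ q) := by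
  have hx := one_sub_exp_pos hs
  set x := 1 - Real.exp (2 * s) with hxdef
  set u : ℝ → ℝ := fun τ => (1 - Real.exp (2 * τ)) / x with hu
  have hupos : ∀ τ ∈ Ioo s 0, 0 < u τ := fun τ hτ => div_pos (one_sub_exp_pos hτ.2) hx
  have hanti : StrictAnti u := fun a b hab => by
    have : Real.exp (2 * a) < Real.exp (2 * b) := Real.exp_lt_exp.2 (by linarith)
    simp only [hu]
    gcongr
  have hu0 : u 0 = 0 := by simp [hu]
  have hus : u s = 1 := by simp only [hu]; exact div_self hx.ne'
  have hcont : Continuous u := by simp only [hu]; fun_prop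
  have himg : (fun τ => u τ ^ q) '' Ioo s 0 = Ioo 0 1 := by
    ext y
    constructor
    · rintro ⟨τ, hτ, rfl⟩
      refine ⟨Real.rpow_pos_of_pos (hupos τ hτ) _, Real.rpow_lt_one (hupos τ hτ).le ?_ hq⟩
      rw [← hus]; exact hanti hτ.1
    · rintro ⟨h0, h1⟩
      have hy0 : 0 < y ^ q⁻¹ := Real.rpow_pos_of_pos h0 _
      have hy1 : y ^ q⁻¹ < 1 := Real.rpow_lt_one h0.le h1 (by positivity)
      have := intermediate_value_Ioo' hs.le hcont.continuousOn
      rw [hu0, hus] at this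
      obtain ⟨τ, hτ, he⟩ := this ⟨hy0, hy1⟩
      refine ⟨τ, hτ, ?_⟩
      beta_reduce
      rw [he, ← Real.rpow_mul h0.le, inv_mul_cancel₀ hq.ne', Real.rpow_one]
  have hder : ∀ τ ∈ Ioo s 0, HasDerivWithinAt (fun τ => u τ ^ q)
      (-(q * u τ ^ (q - 1) * (2 * Real.exp (2 * τ) / x))) (Ioo s 0) τ := fun τ hτ => by
    have h1 : HasDerivAt u (-(2 * Real.exp (2 * τ) / x)) τ := by
      have := ((((hasDerivAt_id τ).const_mul 2).exp).const_sub 1).div_const x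
      convert! this using 1
      simp; ring
    convert! (h1.rpow_const (p := q) (Or.inl (hupos τ hτ).ne')).hasDerivWithinAt using 1
    ring
  have hinj : InjOn (fun τ => u τ ^ q) (Ioo s 0) := fun a ha b hb hab => by
    refine hanti.injective ?_
    exact (Real.rpow_left_inj (hupos a ha).le (hupos b hb).le hq.ne').1 hab
  rw [← himg, lintegral_image_eq_lintegral_abs_deriv_mul measurableSet_Ioo hder hinj]
  refine setLIntegral_congr_fun measurableSet_Ioo fun τ hτ => ?_
  have := hupos τ hτ
  rw [abs_neg, abs_of_nonneg (by positivity)]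

lemma rpow_mul_Hinner_le {α p : ℝ} (hp : 2 < p) {z : ℂ} (hz : z ∈ unitDisk)
    (hz0 : z ≠ 0) :
    ENNReal.ofReal ((1 - ‖z‖ ^ 2) ^ (p * (α + 2) / 2)) * Hinner α z ≤
      ENNReal.ofReal p * radialTail (p / 2 * (α + 2) - 1) (Real.log ‖z‖) := by
  have hp0 : 0 < p := by linarith
  have hs : Real.log ‖z‖ < 0 :=
    Real.log_neg (norm_pos_iff.2 hz0) (norm_lt_one_of_mem_unitDisk hz)
  have hez : Real.exp (2 * Real.log ‖z‖) = ‖z‖ ^ 2 := by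
    rw [two_mul, Real.exp_add, Real.exp_log (norm_pos_iff.2 hz0), sq]
  rw [Hinner, lintegral_Ioo_zero_one_eq_radial (q := p / 2) (by positivity) hs, radialTail,
    ← lintegral_const_mul' _ _ ENNReal.ofReal_ne_top,
    ← lintegral_const_mul' _ _ ENNReal.ofReal_ne_top, hez]
  refine setLIntegral_mono' measurableSet_Ioo fun τ hτ => ?_
  have hx := one_sub_norm_sq_pos hz
  have hy := one_sub_exp_pos hτ.2
  have hyx : 1 - Real.exp (2 * τ) < 1 - ‖z‖ ^ 2 := by
    rw [← hez]
    have : Real.exp (2 * Real.log ‖z‖) < Real.exp (2 * τ) :=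
      Real.exp_lt_exp.2 (by linarith [hτ.1])
    linarith
  have he : Real.exp (2 * τ) = 1 - (1 - Real.exp (2 * τ)) := by ring
  have hepos := Real.exp_pos (2 * τ)
  set x := 1 - ‖z‖ ^ 2
  set E := Real.exp (2 * τ)
  set y := 1 - E with hydef
  have hu0 : 0 < y / x := div_pos hy hx
  have hu1 : y / x < 1 := (div_lt_one hx).2 hyx
  rw [← ENNReal.ofReal_mul (by positivity), ← ENNReal.ofReal_mul (by positivity),
    ← ENNReal.ofReal_mul (by positivity)]
  refine ENNReal.ofReal_le_ofReal ?_
  have hle : x * (y / x) ^ (p / 2) ≤ y := by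
    calc x * (y / x) ^ (p / 2) ≤ x * (y / x) ^ (1 : ℝ) := by
          gcongr x * ?_
          exact Real.rpow_le_rpow_of_exponent_ge hu0 hu1.le (by linarith)
      _ = y := by rw [Real.rpow_one]; field_simp
  have hden : E ≤ 1 - x * (y / x) ^ (p / 2) := by linarith
  have hdpos : 0 < 1 - x * (y / x) ^ (p / 2) := hepos.trans_le hden
  set c := p / 2 * (α + 2) with hc
  have e1 : p * (α + 2) / 2 = c := by rw [hc]; ring
  have e2 : ((y / x) ^ (p / 2)) ^ (α + 1) = (y / x) ^ (c - p / 2) := by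
    rw [← Real.rpow_mul hu0.le]; congr 1; rw [hc]; ring
  have e3 : (y / x) ^ (p / 2 - 1) * (y / x) ^ (c - p / 2) * (x ^ c / x) = y ^ (c - 1) := by
    rw [← Real.rpow_add hu0, ← Real.rpow_sub_one hx.ne',
      show p / 2 - 1 + (c - p / 2) = c - 1 by ring, Real.div_rpow hy.le hx.le,
      div_mul_cancel₀ _ (Real.rpow_pos_of_pos hx _).ne']
  rw [e1, e2]
  calc _ = p * ((y / x) ^ (p / 2 - 1) * (y / x) ^ (c - p / 2) * (x ^ c / x)) *
        (E / (1 - x * (y / x) ^ (p / 2))) := by ring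
    _ ≤ p * y ^ (c - 1) * 1 := by
        rw [e3]
        gcongr
        exact (div_le_one hdpos).2 hden
    _ = _ := by ring

theorem Ffun_le_ApIntPow {α p : ℝ} (hα : -1 ≤ α) (hp : 2 < p) {f : ℂ → ℂ}
    (hf : DifferentiableOn ℂ f unitDisk) :
    Ffun α p f ≤ ApIntPow p (p / 2 * (α + 2) - 2) f := by
  have hp0 : 0 < p := by linarith
  have hpi := Real.pi_pos
  have hβ : -1 < p / 2 * (α + 2) - 2 := by nlinarith
  rw [ApIntPow_eq_hardyStein hp hβ hf, Ffun]
  refine add_le_add le_rfl ?_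
  have e : p ^ 2 / (2 * Real.pi) = p / 2 * (1 / Real.pi) * p := by field_simp
  rw [e, ENNReal.ofReal_mul (by positivity), ENNReal.ofReal_mul (by positivity), one_div,
    ENNReal.ofReal_inv_of_pos hpi, div_eq_mul_inv, mul_assoc, mul_assoc, mul_assoc]
  refine mul_le_mul' le_rfl ?_
  rw [mul_comm]
  refine mul_le_mul' le_rfl ?_
  rw [← lintegral_const_mul' _ _ ENNReal.ofReal_ne_top]
  refine setLIntegral_mono_ae' measurableSet_unitDisk ?_
  filter_upwards [Measure.ae_ne volume (0 : ℂ)] with z hz0 hz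
  have := rpow_mul_Hinner_le (α := α) hp hz hz0
  rw [show p / 2 * (α + 2) - 2 + 1 = p / 2 * (α + 2) - 1 by ring]
  have h1 : 0 ≤ ‖deriv f z‖ ^ 2 * ‖f z‖ ^ (p - 2) := by positivity
  calc _ = ENNReal.ofReal (‖deriv f z‖ ^ 2 * ‖f z‖ ^ (p - 2)) *
        (ENNReal.ofReal ((1 - ‖z‖ ^ 2) ^ (p * (α + 2) / 2)) * Hinner α z) := by
        rw [ENNReal.ofReal_mul h1, mul_assoc]
    _ ≤ ENNReal.ofReal (‖deriv f z‖ ^ 2 * ‖f z‖ ^ (p - 2)) * (ENNReal.ofReal p *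
          radialTail (p / 2 * (α + 2) - 1) (Real.log ‖z‖)) := mul_le_mul' le_rfl this
    _ = _ := mul_left_comm _ _ _

lemma radialTail_le {b : ℝ} (hb : -1 < b) {z : ℂ} (hz : z ∈ unitDisk) :
    radialTail b (Real.log ‖z‖) ≤
      ENNReal.ofReal ((1 - ‖z‖ ^ 2) ^ (b + 1) / (2 * (b + 1) * ‖z‖ ^ 2)) := by
  rcases eq_or_ne z 0 with rfl | hz0
  · simp [radialTail]
  have hb1 : 0 < b + 1 := by linarith
  have hzp := norm_pos_iff.2 hz0
  have hs : Real.log ‖z‖ < 0 := Real.log_neg hzp (norm_lt_one_of_mem_unitDisk hz)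
  have hez : Real.exp (2 * Real.log ‖z‖) = ‖z‖ ^ 2 := by
    rw [two_mul, Real.exp_add, Real.exp_log hzp, sq]
  have h := lintegral_Ioo_radialWeight hb hs
  rw [hez, ← ENNReal.ofReal_mul (by positivity)] at h
  have e : (1 - ‖z‖ ^ 2) ^ (b + 1) / (2 * (b + 1) * ‖z‖ ^ 2) =
    1 / ‖z‖ ^ 2 * (1 / (2 * (b + 1)) * (1 - ‖z‖ ^ 2) ^ (b + 1)) := by field_simp
  rw [e, ENNReal.ofReal_mul (by positivity), ← h, radialTail,
    ← lintegral_const_mul' _ _ ENNReal.ofReal_ne_top]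
  refine setLIntegral_mono' measurableSet_Ioo fun τ hτ => ?_
  have hy := one_sub_exp_pos hτ.2
  rw [← ENNReal.ofReal_mul (by positivity)]
  refine ENNReal.ofReal_le_ofReal ?_
  rw [← mul_assoc]
  refine le_mul_of_one_le_left (by positivity) ?_
  rw [one_div_mul_eq_div, one_le_div (by positivity), ← hez]
  exact Real.exp_le_exp.2 (by linarith [hτ.1])

lemma ccoef_eq_prod {b : ℝ} (hb : 0 < b) (n : ℕ) :
    ccoef b n = ∏ k ∈ Finset.range n, (b + k) / (k + 1) := by
  have hG := (Real.Gamma_pos_of_pos hb).ne'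
  induction n with
  | zero => simp [ccoef, hG]
  | succ n ih =>
    rw [Finset.prod_range_succ, ← ih, ccoef, ccoef]
    have h1 : ((n + 1 : ℕ) : ℝ) + b = (n + b) + 1 := by push_cast; ring
    have h2 : (n : ℝ) + b ≠ 0 := by positivity
    rw [h1, Real.Gamma_add_one h2, Nat.factorial_succ]
    push_cast
    have := Nat.factorial_pos n
    field_simp
    ring

lemma ccoef_pos {b : ℝ} (hb : 0 < b) (n : ℕ) : 0 < ccoef b n := by
  rw [ccoef_eq_prod hb]
  exact Finset.prod_pos fun k _ => by positivity

lemma ccoef_succ {b : ℝ} (hb : 0 < b) (n : ℕ) :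
    ccoef b (n + 1) = ccoef b n * ((b + n) / (n + 1)) := by
  rw [ccoef_eq_prod hb, ccoef_eq_prod hb, Finset.prod_range_succ]

lemma ccoef_mono {b b' : ℝ} (hb : 0 < b) (h : b ≤ b') (n : ℕ) : ccoef b n ≤ ccoef b' n := by
  rw [ccoef_eq_prod hb, ccoef_eq_prod (hb.trans_le h)]
  exact Finset.prod_le_prod (fun k _ => by positivity) fun k _ => by gcongr

lemma continuousAt_ccoef {b : ℝ} (hb : 0 < b) (n : ℕ) : ContinuousAt (fun b => ccoef b n) b := by
  have : (fun b : ℝ => ∏ k ∈ Finset.range n, (b + k) / (k + 1)) =ᶠ[𝓝 b] fun b => ccoef b n := by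
    filter_upwards [lt_mem_nhds hb] with x hx using (ccoef_eq_prod hx n).symm
  refine ContinuousAt.congr ?_ this
  fun_prop

lemma integrableOn_radialMoment {b : ℝ} (hb : -1 < b) (n : ℕ) :
    IntegrableOn (fun t : ℝ => Real.exp (2 * t) ^ n *
      (Real.exp (2 * t) * (1 - Real.exp (2 * t)) ^ b)) (Iio 0) := by
  have h0 : IntegrableOn (fun t : ℝ => Real.exp (2 * t) * (1 - Real.exp (2 * t)) ^ b) (Iio 0) := by
    refine ⟨by fun_prop, ?_⟩
    rw [hasFiniteIntegral_iff_ofReal, lintegral_Iio_radialWeight hb]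
    · exact ENNReal.ofReal_lt_top
    · filter_upwards [ae_restrict_mem measurableSet_Iio] with t ht
      have := one_sub_exp_pos ht
      positivity
  refine h0.mono' (by fun_prop) ?_
  filter_upwards [ae_restrict_mem measurableSet_Iio] with t ht
  have := one_sub_exp_pos ht
  rw [Real.norm_of_nonneg (by positivity)]
  refine mul_le_of_le_one_left (by positivity) (pow_le_one₀ (by positivity) (by linarith))

lemma integral_radialMoment {b : ℝ} (hb : -1 < b) (n : ℕ) :
    ∫ t in Iio (0 : ℝ), Real.exp (2 * t) ^ n *
      (Real.exp (2 * t) * (1 - Real.exp (2 * t)) ^ b) = 1 / (2 * (b + 1) * ccoef (b + 2) n) := by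
  have hb1 : 0 < b + 1 := by linarith
  have hb2 : 0 < b + 2 := by linarith
  induction n with
  | zero =>
    have h1 := lintegral_Iio_radialWeight hb
    have hnn : 0 ≤ᵐ[volume.restrict (Iio 0)]
        fun t : ℝ => Real.exp (2 * t) * (1 - Real.exp (2 * t)) ^ b := by
      filter_upwards [ae_restrict_mem measurableSet_Iio] with t ht
      have := one_sub_exp_pos ht
      positivity
    simp only [pow_zero, one_mul]
    rw [integral_eq_lintegral_of_nonneg_ae hnn (by fun_prop), h1,
      ENNReal.toReal_ofReal (by positivity), ccoef_eq_prod hb2]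
    simp
  | succ n ih =>
    have hn : (0 : ℝ) < n + 1 := by positivity
    have hI := integrableOn_radialMoment hb n
    have hI' := integrableOn_radialMoment hb (n + 1)
    have hd : ∀ t ∈ Iio (0 : ℝ), HasDerivAt
        (fun t => Real.exp (2 * t) ^ (n + 1) * (1 - Real.exp (2 * t)) ^ (b + 1))
        (2 * (n + 1) * (Real.exp (2 * t) ^ n * (Real.exp (2 * t) * (1 - Real.exp (2 * t)) ^ b)) -
          2 * (b + 2 + n) * (Real.exp (2 * t) ^ (n + 1) *
            (Real.exp (2 * t) * (1 - Real.exp (2 * t)) ^ b))) t := fun t ht => by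
      have h1 := (((hasDerivAt_id t).const_mul 2).exp).pow (n + 1)
      have h2 := (hasDerivAt_one_sub_exp_rpow b ht).neg
      have h3 := h1.mul h2
      convert! h3 using 1
      · ext t; simp
      · have h4 := one_sub_exp_pos ht
        simp only [neg_neg, id, Pi.neg_apply, Pi.pow_apply, add_tsub_cancel_right]
        rw [Real.rpow_add_one h4.ne']
        push_cast
        ring
    have hexp : Tendsto (fun t : ℝ => Real.exp (2 * t)) atBot (𝓝 0) :=
      Real.tendsto_exp_atBot.comp (tendsto_id.const_mul_atBot (by norm_num))
    have hlim : Tendsto (fun t : ℝ => Real.exp (2 * t) ^ (n + 1) *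
        (1 - Real.exp (2 * t)) ^ (b + 1)) atBot (𝓝 0) := by
      have := (hexp.pow (n + 1)).mul ((hexp.const_sub 1).rpow_const (p := b + 1) (Or.inr hb1.le))
      simpa using this
    have hkint := (hI.const_mul (2 * (n + 1))).sub (hI'.const_mul (2 * (b + 2 + n)))
    have h := integral_Iic_of_hasDerivAt_of_tendsto (a := (0 : ℝ)) ?_ hd
      ((integrableOn_Iic_iff_integrableOn_Iio (by finiteness)).2 hkint) hlim
    · rw [integral_Iic_eq_integral_Iio, integral_sub (hI.const_mul _) (hI'.const_mul _),
        integral_const_mul, integral_const_mul, ih] at h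
      simp only [mul_zero, Real.exp_zero, sub_self, Real.zero_rpow hb1.ne'] at h
      rw [ccoef_succ hb2]
      have hc := ccoef_pos hb2 n
      have hbn : 0 < b + 2 + n := by positivity
      rw [sub_eq_zero] at h
      have h' : ∀ X : ℝ, 2 * ((n : ℝ) + 1) * (1 / (2 * (b + 1) * ccoef (b + 2) n)) =
          2 * (b + 2 + n) * X →
          X = 1 / (2 * (b + 1) * (ccoef (b + 2) n * ((b + 2 + n) / (n + 1)))) := fun X hX => by
        field_simp at hX ⊢
        linarith
      exact h' _ h
    · exact ((by fun_prop : Continuous fun t : ℝ => Real.exp (2 * t) ^ (n + 1)).mul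
        (Continuous.rpow_const (by fun_prop) fun _ => Or.inr hb1.le)).continuousWithinAt

lemma lintegral_radialMoment {b : ℝ} (hb : -1 < b) (n : ℕ) :
    ∫⁻ t in Iio (0 : ℝ), ENNReal.ofReal (Real.exp (2 * t) ^ n *
      (Real.exp (2 * t) * (1 - Real.exp (2 * t)) ^ b)) =
      ENNReal.ofReal (1 / (2 * (b + 1) * ccoef (b + 2) n)) := by
  rw [← integral_radialMoment hb n, ofReal_integral_eq_lintegral_ofReal
    (integrableOn_radialMoment hb n)]
  filter_upwards [ae_restrict_mem measurableSet_Iio] with t ht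
  have := one_sub_exp_pos ht
  positivity

lemma hasSum_taylorCoeff {f : ℂ → ℂ} (hf : DifferentiableOn ℂ f unitDisk) {z : ℂ}
    (hz : z ∈ unitDisk) : HasSum (fun n => taylorCoeff f n * z ^ n) (f z) := by
  have := Complex.hasSum_taylorSeries_on_ball (c := 0) (r := 1) hf hz
  refine this.congr_fun fun n => ?_
  simp only [taylorCoeff, sub_zero, smul_eq_mul]
  ring

open Polynomial in
lemma integral_norm_sq_polynomial_circle (p : ℂ[X]) (N : ℕ) (hN : p.natDegree < N) :
    ∫ θ in (-Real.pi)..Real.pi, ‖p.eval (Complex.exp (θ * Complex.I))‖ ^ 2 =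
      2 * Real.pi * ∑ n ∈ Finset.range N, ‖p.coeff n‖ ^ 2 := by
  have h := p.sum_sq_norm_coeff_eq_circleAverage
  rw [Real.circleAverage_def] at h
  have hsum : ∑ i ∈ p.support, ‖p.coeff i‖ ^ 2 = ∑ n ∈ Finset.range N, ‖p.coeff n‖ ^ 2 := by
    refine Finset.sum_subset (fun i hi => ?_) fun i _ hi => ?_
    · exact Finset.mem_range.2 ((le_natDegree_of_mem_supp i hi).trans_lt hN)
    · rw [notMem_support_iff.1 hi]; simp
  have hper : Function.Periodic (fun θ : ℝ => ‖p.eval (circleMap 0 1 θ)‖ ^ 2) (2 * Real.pi) :=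
    fun θ => by
      beta_reduce
      rw [periodic_circleMap 0 1 θ]
  have := hper.intervalIntegral_add_eq 0 (-Real.pi)
  rw [zero_add, show -Real.pi + 2 * Real.pi = Real.pi by ring] at this
  rw [hsum, this, smul_eq_mul] at h
  have hpi := Real.pi_pos
  rw [h, ← mul_assoc, mul_inv_cancel₀ (by positivity), one_mul]
  simp [circleMap]

/-- **Parseval's identity** on the circle of radius `e^s`. -/
lemma lintegral_circle_norm_sq {f : ℂ → ℂ} (hf : DifferentiableOn ℂ f unitDisk) {s : ℝ}
    (hs : s < 0) :
    ∫⁻ θ in Ioc (-Real.pi) Real.pi, ENNReal.ofReal (‖f (Complex.exp (s + θ * Complex.I))‖ ^ 2) =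
      ∑' n, ENNReal.ofReal (2 * Real.pi * ‖taylorCoeff f n‖ ^ 2) *
        ENNReal.ofReal (Real.exp (2 * s) ^ n) := by
  have hmem := fun θ : ℝ => exp_add_mul_I_mem_unitDisk hs θ
  have hsm : Summable fun n => ‖taylorCoeff f n‖ * Real.exp s ^ n := by
    have := (hasSum_taylorCoeff hf (hmem 0)).summable.norm
    simpa [norm_mul, norm_pow, Complex.norm_exp] using this
  have hcomp : Continuous fun θ : ℝ => f (Complex.exp (s + θ * Complex.I)) :=
    hf.continuousOn.comp_continuous (by fun_prop) hmem
  have hlim : Tendsto (fun N => ∫ θ in (-Real.pi)..Real.pi, ‖∑ n ∈ Finset.range N,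
      taylorCoeff f n * Complex.exp (s + θ * Complex.I) ^ n‖ ^ 2) atTop
      (𝓝 (∫ θ in (-Real.pi)..Real.pi, ‖f (Complex.exp (s + θ * Complex.I))‖ ^ 2)) := by
    refine intervalIntegral.tendsto_integral_filter_of_dominated_convergence
      (fun _ => (∑' n, ‖taylorCoeff f n‖ * Real.exp s ^ n) ^ 2) ?_ ?_ intervalIntegrable_const ?_
    · exact Eventually.of_forall fun N => Continuous.aestronglyMeasurable (by fun_prop)
    · refine Eventually.of_forall fun N => ae_of_all _ fun θ _ => ?_
      rw [Real.norm_of_nonneg (by positivity)]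
      gcongr
      refine (norm_sum_le _ _).trans ?_
      simp only [norm_mul, norm_pow, norm_exp_add_mul_I]
      exact hsm.sum_le_tsum _ fun n _ => by positivity
    · exact ae_of_all _ fun θ _ => ((hasSum_taylorCoeff hf (hmem θ)).tendsto_sum_nat.norm.pow 2)
  have hfin : ∀ N, ∫ θ in (-Real.pi)..Real.pi, ‖∑ n ∈ Finset.range N,
      taylorCoeff f n * Complex.exp (s + θ * Complex.I) ^ n‖ ^ 2 =
      ∑ n ∈ Finset.range N, 2 * Real.pi * ‖taylorCoeff f n‖ ^ 2 * Real.exp (2 * s) ^ n :=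
      fun N => by
    set P : Polynomial ℂ := ∑ n ∈ Finset.range N,
      Polynomial.monomial n (taylorCoeff f n * Complex.exp s ^ n) with hP
    have hcoeff : ∀ n < N, P.coeff n = taylorCoeff f n * Complex.exp s ^ n := fun n hn => by
      simp [hP, Polynomial.coeff_monomial, hn]
    rcases Nat.eq_zero_or_pos N with rfl | hN
    · simp
    have hdeg : P.natDegree < N := by
      have : P.natDegree ≤ N - 1 := Polynomial.natDegree_sum_le_of_forall_le _ _ fun n hn =>
        (Polynomial.natDegree_monomial_le _).trans (by have := Finset.mem_range.1 hn; omega)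
      omega
    have h := integral_norm_sq_polynomial_circle P N hdeg
    have e : ∀ θ : ℝ, P.eval (Complex.exp (θ * Complex.I)) = ∑ n ∈ Finset.range N,
        taylorCoeff f n * Complex.exp (s + θ * Complex.I) ^ n := fun θ => by
      simp only [hP, Polynomial.eval_finsetSum, Polynomial.eval_monomial]
      refine Finset.sum_congr rfl fun n _ => ?_
      rw [Complex.exp_add, mul_pow, mul_assoc]
    simp only [e] at h
    rw [h, Finset.mul_sum]
    refine Finset.sum_congr rfl fun n hn => ?_
    rw [hcoeff n (Finset.mem_range.1 hn), norm_mul, norm_pow, Complex.norm_exp, Complex.ofReal_re,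
      two_mul s, Real.exp_add]
    ring
  rw [← ofReal_integral_eq_lintegral_ofReal, ← intervalIntegral.integral_of_le neg_pi_le_pi]
  · simp only [hfin] at hlim
    have h2 := (ENNReal.continuous_ofReal.tendsto _).comp hlim
    refine tendsto_nhds_unique h2 ?_
    refine (ENNReal.summable.hasSum.tendsto_sum_nat).congr fun N => ?_
    simp only [Function.comp]
    rw [ENNReal.ofReal_sum_of_nonneg fun n _ => by have := Real.pi_pos; positivity]
    refine Finset.sum_congr rfl fun n _ => ?_
    rw [← ENNReal.ofReal_mul (by have := Real.pi_pos; positivity)]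
  · exact (hcomp.norm.pow 2).integrableOn_Ioc
  · exact ae_of_all _ fun θ => by positivity

/-- The coefficient norm agrees with the Bergman norm. -/
theorem A2normSq_eq_ApIntPow {α : ℝ} (hα : -1 < α) {f : ℂ → ℂ}
    (hf : DifferentiableOn ℂ f unitDisk) : A2normSq α f = ApIntPow 2 α f := by
  have hα1 : 0 < α + 1 := by linarith
  have hα2 : 0 < α + 2 := by linarith
  have hpi := Real.pi_pos
  have hL : ∫⁻ z in unitDisk, ENNReal.ofReal ((1 - ‖z‖ ^ 2) ^ α * ‖f z‖ ^ (2 : ℝ)) =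
      ∑' n, ENNReal.ofReal (2 * Real.pi * ‖taylorCoeff f n‖ ^ 2) *
        ENNReal.ofReal (1 / (2 * (α + 1) * ccoef (α + 2) n)) := by
    simp only [Real.rpow_two]
    rw [lintegral_unitDisk_eq]
    · have : ∀ t ∈ Iio (0 : ℝ), ENNReal.ofReal (Real.exp (2 * t)) *
          ∫⁻ θ in Ioc (-Real.pi) Real.pi, ENNReal.ofReal
            ((1 - ‖Complex.exp (t + θ * Complex.I)‖ ^ 2) ^ α *
              ‖f (Complex.exp (t + θ * Complex.I))‖ ^ 2) =
          ∑' n, ENNReal.ofReal (2 * Real.pi * ‖taylorCoeff f n‖ ^ 2) *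
            ENNReal.ofReal (Real.exp (2 * t) ^ n *
              (Real.exp (2 * t) * (1 - Real.exp (2 * t)) ^ α)) := fun t ht => by
        have hpos := one_sub_exp_pos ht
        have : ∀ θ : ℝ, ENNReal.ofReal ((1 - ‖Complex.exp (t + θ * Complex.I)‖ ^ 2) ^ α *
            ‖f (Complex.exp (t + θ * Complex.I))‖ ^ 2) =
            ENNReal.ofReal ((1 - Real.exp (2 * t)) ^ α) *
            ENNReal.ofReal (‖f (Complex.exp (t + θ * Complex.I))‖ ^ 2) := fun θ => by
          rw [norm_exp_add_mul_I, ← Real.exp_nat_mul, ENNReal.ofReal_mul]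
          · norm_cast
          · push_cast; positivity
        simp only [this]
        rw [lintegral_const_mul' _ _ ENNReal.ofReal_ne_top, lintegral_circle_norm_sq hf ht,
          ← mul_assoc, ← ENNReal.ofReal_mul (by positivity), ← ENNReal.tsum_mul_left]
        refine tsum_congr fun n => ?_
        rw [ENNReal.ofReal_mul (by positivity : 0 ≤ Real.exp (2 * t) ^ n)]
        ring
      rw [setLIntegral_congr_fun measurableSet_Iio this, lintegral_tsum fun n => by fun_prop]
      refine tsum_congr fun n => ?_
      rw [lintegral_const_mul' _ _ ENNReal.ofReal_ne_top, lintegral_radialMoment hα]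
    · refine measurable_indicator_of_continuousOn measurableSet_unitDisk
        (ENNReal.continuous_ofReal.comp_continuousOn
          (ContinuousOn.mul ?_ (hf.continuousOn.norm.pow 2)))
      exact ContinuousOn.rpow_const (by fun_prop)
        fun z hz => Or.inl (one_sub_norm_sq_pos hz).ne'
  rw [ApIntPow, hL, A2normSq, ENNReal.div_eq_inv_mul, ← ENNReal.ofReal_inv_of_pos hpi,
    ← mul_assoc, ← ENNReal.ofReal_mul (by positivity), ← ENNReal.tsum_mul_left]
  refine tsum_congr fun n => ?_
  have hc := ccoef_pos hα2 n
  rw [← ENNReal.ofReal_mul (by positivity), ← ENNReal.ofReal_mul (by positivity)]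
  congr 1
  field_simp

/-- The involutive disk automorphism exchanging `0` and `w`. -/
def diskInvolution (w : ℝ) (z : ℂ) : ℂ := (w - z) / (1 - w * z)

/-- The modulus of the derivative of `diskInvolution w`. -/
def diskInvolutionFactor (w : ℝ) (z : ℂ) : ℝ := (1 - w ^ 2) / ‖1 - w * z‖ ^ 2

section Involution

variable {w : ℝ} {z : ℂ}

lemma re_one_sub_mul_pos (h0 : 0 ≤ w) (h1 : w < 1) (hz : z ∈ unitDisk) :
    0 < (1 - w * z).re := by
  have h2 := (Complex.re_le_norm z).trans_lt (norm_lt_one_of_mem_unitDisk hz)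
  simp only [Complex.sub_re, Complex.one_re, Complex.re_ofReal_mul]
  nlinarith

lemma one_sub_mul_ne_zero (h0 : 0 ≤ w) (h1 : w < 1) (hz : z ∈ unitDisk) :
    (1 - w * z : ℂ) ≠ 0 := fun h => by
  have := re_one_sub_mul_pos h0 h1 hz
  rw [h] at this
  simp at this

lemma one_sub_sq_pos (h0 : 0 ≤ w) (h1 : w < 1) : 0 < 1 - w ^ 2 := by nlinarith

lemma diskInvolutionFactor_pos (h0 : 0 ≤ w) (h1 : w < 1) (hz : z ∈ unitDisk) :
    0 < diskInvolutionFactor w z := by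
  have := norm_pos_iff.2 (one_sub_mul_ne_zero h0 h1 hz)
  have := one_sub_sq_pos h0 h1
  rw [diskInvolutionFactor]; positivity

lemma one_sub_norm_sq_diskInvolution (h0 : 0 ≤ w) (h1 : w < 1) (hz : z ∈ unitDisk) :
    1 - ‖diskInvolution w z‖ ^ 2 = diskInvolutionFactor w z * (1 - ‖z‖ ^ 2) := by
  have hne := norm_pos_iff.2 (one_sub_mul_ne_zero h0 h1 hz)
  rw [diskInvolution, diskInvolutionFactor, norm_div, div_pow, div_mul_eq_mul_div,
    eq_div_iff (by positivity), sub_mul, div_mul_cancel₀ _ (by positivity), one_mul]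
  simp only [Complex.sq_norm, Complex.normSq_apply, Complex.sub_re, Complex.sub_im,
    Complex.one_re, Complex.one_im, Complex.re_ofReal_mul, Complex.im_ofReal_mul,
    Complex.ofReal_re, Complex.ofReal_im]
  ring

lemma diskInvolution_mem (h0 : 0 ≤ w) (h1 : w < 1) (hz : z ∈ unitDisk) :
    diskInvolution w z ∈ unitDisk := by
  have h2 := one_sub_norm_sq_diskInvolution h0 h1 hz
  have h3 := mul_pos (diskInvolutionFactor_pos h0 h1 hz) (one_sub_norm_sq_pos hz)
  rw [unitDisk, mem_ball_zero_iff]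
  nlinarith [norm_nonneg (diskInvolution w z)]

lemma diskInvolution_diskInvolution (h0 : 0 ≤ w) (h1 : w < 1) (hz : z ∈ unitDisk) :
    diskInvolution w (diskInvolution w z) = z := by
  have hne := one_sub_mul_ne_zero h0 h1 hz
  have hw : (1 - w ^ 2 : ℂ) ≠ 0 := by
    exact_mod_cast (one_sub_sq_pos h0 h1).ne'
  have e1 : (w : ℂ) - (w - z) / (1 - w * z) = (1 - w ^ 2) * z / (1 - w * z) := by
    field_simp; ring
  have e2 : (1 : ℂ) - w * ((w - z) / (1 - w * z)) = (1 - w ^ 2) / (1 - w * z) := by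
    field_simp; ring
  rw [diskInvolution, diskInvolution, e1, e2]
  field_simp

lemma image_diskInvolution (h0 : 0 ≤ w) (h1 : w < 1) :
    diskInvolution w '' unitDisk = unitDisk := by
  ext z
  refine ⟨?_, fun hz => ⟨_, diskInvolution_mem h0 h1 hz, diskInvolution_diskInvolution h0 h1 hz⟩⟩
  rintro ⟨y, hy, rfl⟩
  exact diskInvolution_mem h0 h1 hy

lemma injOn_diskInvolution (h0 : 0 ≤ w) (h1 : w < 1) : InjOn (diskInvolution w) unitDisk :=
  fun x hx y hy h => by
    rw [← diskInvolution_diskInvolution h0 h1 hx, h, diskInvolution_diskInvolution h0 h1 hy]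

lemma hasDerivAt_diskInvolution (h0 : 0 ≤ w) (h1 : w < 1) (hz : z ∈ unitDisk) :
    HasDerivAt (diskInvolution w) (-(1 - w ^ 2) / (1 - w * z) ^ 2) z := by
  have hne := one_sub_mul_ne_zero h0 h1 hz
  have h2 : HasDerivAt (fun z : ℂ => (w : ℂ) - z) (-1) z := (hasDerivAt_id z).const_sub _
  have h3 : HasDerivAt (fun z : ℂ => 1 - (w : ℂ) * z) (-w) z := by
    simpa using ((hasDerivAt_id z).const_mul (w : ℂ)).const_sub 1
  convert! h2.div h3 hne using 1
  congr 1
  ring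

lemma norm_deriv_diskInvolution (h0 : 0 ≤ w) (h1 : w < 1) :
    ‖(-(1 - w ^ 2) / (1 - w * z) ^ 2 : ℂ)‖ = diskInvolutionFactor w z := by
  rw [norm_div, norm_neg, norm_pow, diskInvolutionFactor]
  congr 1
  rw [show (1 - w ^ 2 : ℂ) = ((1 - w ^ 2 : ℝ) : ℂ) by push_cast; rfl, Complex.norm_real,
    Real.norm_of_nonneg (one_sub_sq_pos h0 h1).le]

lemma lintegral_unitDisk_diskInvolution (h0 : 0 ≤ w) (h1 : w < 1) (F : ℂ → ℝ≥0∞) :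
    ∫⁻ z in unitDisk, F z = ∫⁻ z in unitDisk,
      ENNReal.ofReal (diskInvolutionFactor w z ^ 2) * F (diskInvolution w z) := by
  conv_lhs => rw [← image_diskInvolution h0 h1]
  rw [lintegral_image_eq_lintegral_norm_deriv_sq_mul measurableSet_unitDisk
    (fun z hz => hasDerivAt_diskInvolution h0 h1 hz) (injOn_diskInvolution h0 h1)]
  simp only [norm_deriv_diskInvolution h0 h1]

lemma ApIntPow_eq_of_diskInvolution (h0 : 0 ≤ w) (h1 : w < 1) (p β : ℝ) {f g : ℂ → ℂ}
    (hg : ∀ z ∈ unitDisk, ‖g z‖ ^ p =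
      diskInvolutionFactor w z ^ (β + 2) * ‖f (diskInvolution w z)‖ ^ p) :
    ApIntPow p β g = ApIntPow p β f := by
  rw [ApIntPow, ApIntPow]
  congr 2
  rw [lintegral_unitDisk_diskInvolution h0 h1
    fun z => ENNReal.ofReal ((1 - ‖z‖ ^ 2) ^ β * ‖f z‖ ^ p)]
  refine setLIntegral_congr_fun measurableSet_unitDisk fun z hz => ?_
  have hJ := diskInvolutionFactor_pos h0 h1 hz
  rw [← ENNReal.ofReal_mul (by positivity), hg z hz, one_sub_norm_sq_diskInvolution h0 h1 hz,
    Real.mul_rpow hJ.le (one_sub_norm_sq_pos hz).le, Real.rpow_add hJ, Real.rpow_two]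
  congr 1
  ring

lemma le_diskInvolutionFactor (h0 : 0 ≤ w) (h1 : w < 1) (hz : z ∈ unitDisk) :
    (1 - w ^ 2) / 4 ≤ diskInvolutionFactor w z := by
  have hne := norm_pos_iff.2 (one_sub_mul_ne_zero h0 h1 hz)
  have := one_sub_sq_pos h0 h1
  rw [diskInvolutionFactor]
  have h2 : ‖(1 - w * z : ℂ)‖ ≤ 2 := by
    refine (norm_sub_le _ _).trans ?_
    rw [norm_mul, Complex.norm_real, Real.norm_of_nonneg h0, norm_one]
    nlinarith [norm_lt_one_of_mem_unitDisk hz, norm_nonneg z]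
  gcongr
  nlinarith

lemma diskInvolutionFactor_le (h0 : 0 ≤ w) (h1 : w < 1) {ρ : ℝ} (hρ : ρ < 1) (hz : ‖z‖ ≤ ρ) :
    diskInvolutionFactor w z ≤ (1 - w ^ 2) / (1 - ρ) ^ 2 := by
  have := one_sub_sq_pos h0 h1
  rw [diskInvolutionFactor]
  have h2 : 1 - ρ ≤ ‖(1 - w * z : ℂ)‖ := by
    refine le_trans ?_ (norm_sub_norm_le _ _)
    rw [norm_mul, Complex.norm_real, Real.norm_of_nonneg h0, norm_one]
    nlinarith [norm_nonneg z]
  have h3 : 0 < 1 - ρ := by linarith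
  gcongr

end Involution

lemma ApIntPow_mono_of_norm_le {p β : ℝ} {f g : ℂ → ℂ} {c : ℝ} (hc : 0 ≤ c)
    (h : ∀ z ∈ unitDisk, ‖g z‖ ^ p ≤ c * ‖f z‖ ^ p) :
    ApIntPow p β g ≤ ENNReal.ofReal c * ApIntPow p β f := by
  rw [ApIntPow, ApIntPow, ← mul_div_assoc, mul_left_comm]
  refine ENNReal.div_le_div_right (mul_le_mul' le_rfl ?_) _
  rw [← lintegral_const_mul' _ _ ENNReal.ofReal_ne_top]
  refine setLIntegral_mono' measurableSet_unitDisk fun z hz => ?_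
  rw [← ENNReal.ofReal_mul hc]
  refine ENNReal.ofReal_le_ofReal ?_
  have := one_sub_norm_sq_pos hz
  calc _ ≤ (1 - ‖z‖ ^ 2) ^ β * (c * ‖f z‖ ^ p) := by gcongr; exact h z hz
    _ = _ := by ring

/-- The weighted composition operator with symbol `diskInvolution w` that acts isometrically on
`A²_{a-2}`. -/
def mobiusTransport (a w : ℝ) (f : ℂ → ℂ) (z : ℂ) : ℂ :=
  f (diskInvolution w z) * (((1 - w ^ 2 : ℝ) ^ (a / 2) : ℝ) * (1 - w * z) ^ ((-a : ℝ) : ℂ))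

section Transport

variable {a w : ℝ} {f : ℂ → ℂ}

lemma norm_mobiusTransport (h0 : 0 ≤ w) (h1 : w < 1) (z : ℂ) :
    ‖mobiusTransport a w f z‖ =
      diskInvolutionFactor w z ^ (a / 2) * ‖f (diskInvolution w z)‖ := by
  have hw := one_sub_sq_pos h0 h1
  rw [mobiusTransport, norm_mul, norm_mul, Complex.norm_cpow_real, Complex.norm_real,
    Real.norm_of_nonneg (by positivity), diskInvolutionFactor,
    Real.div_rpow hw.le (by positivity), ← Real.rpow_natCast_mul (norm_nonneg _),
    Real.rpow_neg (norm_nonneg _)]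
  rw [show ((2 : ℕ) : ℝ) * (a / 2) = a by push_cast; ring]
  ring

lemma differentiableOn_mobiusTransport (h0 : 0 ≤ w) (h1 : w < 1)
    (hf : DifferentiableOn ℂ f unitDisk) :
    DifferentiableOn ℂ (mobiusTransport a w f) unitDisk := by
  have h2 : DifferentiableOn ℂ (fun z => f (diskInvolution w z)) unitDisk :=
    hf.comp (fun z hz => (hasDerivAt_diskInvolution h0 h1 hz).differentiableAt
      |>.differentiableWithinAt) fun z hz => diskInvolution_mem h0 h1 hz
  refine h2.mul (DifferentiableOn.const_mul ?_ _)
  exact DifferentiableOn.cpow_const (by fun_prop) fun z hz =>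
    Complex.mem_slitPlane_iff.2 (Or.inl (re_one_sub_mul_pos h0 h1 hz))

lemma ApIntPow_mobiusTransport (h0 : 0 ≤ w) (h1 : w < 1) (p β : ℝ) (ha : p * a / 2 = β + 2) :
    ApIntPow p β (mobiusTransport a w f) = ApIntPow p β f := by
  refine ApIntPow_eq_of_diskInvolution h0 h1 p β fun z hz => ?_
  have hJ := diskInvolutionFactor_pos h0 h1 hz
  rw [norm_mobiusTransport h0 h1 z, Real.mul_rpow (by positivity) (norm_nonneg _),
    ← Real.rpow_mul hJ.le, ← ha]
  congr 2
  ring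

lemma A2normSq_mono_weight {α α' : ℝ} (hα : -1 ≤ α) (h : α ≤ α') (f : ℂ → ℂ) :
    A2normSq α' f ≤ A2normSq α f := by
  refine ENNReal.tsum_le_tsum fun n => ENNReal.ofReal_le_ofReal ?_
  have h1 := ccoef_pos (b := α + 2) (by linarith) n
  have h2 := ccoef_mono (b := α + 2) (b' := α' + 2) (by linarith) (by linarith) n
  gcongr

lemma A2normSq_le_of_forall_gt {α : ℝ} (hα : -1 ≤ α) {g : ℂ → ℂ} {X : ℝ≥0∞} {κ : ℝ} (hκ : 0 < κ)
    (h : ∀ α' > α, A2normSq α' g ≤ ENNReal.ofReal (κ ^ (α - α')) * X) : A2normSq α g ≤ X := by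
  refine ENNReal.tsum_le_of_sum_range_le fun N => ?_
  have hL : Tendsto (fun α' => ∑ n ∈ Finset.range N,
      ENNReal.ofReal (‖taylorCoeff g n‖ ^ 2 / ccoef (α' + 2) n)) (𝓝[>] α)
      (𝓝 (∑ n ∈ Finset.range N, ENNReal.ofReal (‖taylorCoeff g n‖ ^ 2 / ccoef (α + 2) n))) := by
    refine tendsto_finsetSum _ fun n _ => ?_
    refine (ENNReal.continuous_ofReal.tendsto _).comp ?_
    have h2 : 0 < α + 2 := by linarith
    have h3 : Tendsto (fun α' => ccoef (α' + 2) n) (𝓝[>] α) (𝓝 (ccoef (α + 2) n)) :=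
      (ContinuousAt.comp (f := fun α' => α' + 2) (g := fun b => ccoef b n)
        (continuousAt_ccoef h2 n) (by fun_prop)).tendsto.mono_left nhdsWithin_le_nhds
    exact tendsto_const_nhds.div h3 (ccoef_pos h2 n).ne'
  have hR : Tendsto (fun α' => ENNReal.ofReal (κ ^ (α - α')) * X) (𝓝[>] α) (𝓝 (1 * X)) := by
    refine ENNReal.Tendsto.mul_const ?_ (Or.inl one_ne_zero)
    have h2 : Tendsto (fun α' => κ ^ (α - α')) (𝓝[>] α) (𝓝 (κ ^ (α - α))) := by
      refine Tendsto.mono_left ?_ nhdsWithin_le_nhds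
      have : Continuous fun α' => κ ^ (α - α') :=
        Continuous.rpow continuous_const (by fun_prop) fun _ => Or.inl hκ.ne'
      exact this.tendsto α
    have := (ENNReal.continuous_ofReal.tendsto _).comp h2
    rw [sub_self, Real.rpow_zero, ENNReal.ofReal_one] at this
    exact this
  rw [one_mul] at hR
  refine le_of_tendsto_of_tendsto hL hR ?_
  filter_upwards [self_mem_nhdsWithin] with α' hα'
  exact (ENNReal.sum_le_tsum _).trans (h α' hα')

/-- Contractivity on `A²_α` of transport followed by a pointwise contraction. -/
lemma A2normSq_le_of_norm_le_mobiusTransport {α : ℝ} (hα : -1 ≤ α) (h0 : 0 ≤ w) (h1 : w < 1)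
    (hf : DifferentiableOn ℂ f unitDisk) {g : ℂ → ℂ} (hg : DifferentiableOn ℂ g unitDisk)
    (hle : ∀ z ∈ unitDisk, ‖g z‖ ≤ ‖mobiusTransport (α + 2) w f z‖) :
    A2normSq α g ≤ A2normSq α f := by
  have hκ : 0 < (1 - w ^ 2) / 4 := by have := one_sub_sq_pos h0 h1; positivity
  refine A2normSq_le_of_forall_gt hα hκ fun α' hα' => ?_
  have hα1 : -1 < α' := by linarith
  have hα0 : α < α' := hα'
  refine le_trans ?_ (mul_le_mul' le_rfl (A2normSq_mono_weight hα hα0.le f))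
  rw [A2normSq_eq_ApIntPow hα1 hg, A2normSq_eq_ApIntPow hα1 hf,
    ← ApIntPow_mobiusTransport (a := α' + 2) (f := f) h0 h1 2 α' (by ring)]
  refine ApIntPow_mono_of_norm_le (by positivity) fun z hz => ?_
  have hJ := diskInvolutionFactor_pos h0 h1 hz
  have h3 := hle z hz
  rw [norm_mobiusTransport h0 h1 z] at h3 ⊢
  simp only [Real.rpow_two]
  set J := diskInvolutionFactor w z
  set X := ‖f (diskInvolution w z)‖
  calc ‖g z‖ ^ 2 ≤ (J ^ ((α + 2) / 2) * X) ^ 2 := by gcongr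
    _ = J ^ (α - α') * (J ^ ((α' + 2) / 2) * X) ^ 2 := by
        rw [mul_pow, mul_pow, ← Real.rpow_natCast (J ^ ((α + 2) / 2)), ← Real.rpow_mul hJ.le,
          ← Real.rpow_natCast (J ^ ((α' + 2) / 2)), ← Real.rpow_mul hJ.le, ← mul_assoc,
          ← Real.rpow_add hJ]
        congr 2
        push_cast
        ring
    _ ≤ _ := by
        gcongr ?_ * _
        exact Real.rpow_le_rpow_of_nonpos hκ (le_diskInvolutionFactor h0 h1 hz) (by linarith)

end Transport

lemma ApIntPow_one {p β : ℝ} (hp : 2 < p) (hβ : -1 < β) : ApIntPow p β (fun _ => 1) = 1 := by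
  rw [ApIntPow_eq_hardyStein hp hβ (differentiableOn_const _)]
  simp

lemma volume_unitDisk : volume unitDisk = ENNReal.ofReal Real.pi := by
  rw [unitDisk, Complex.volume_ball]
  rw [← NNReal.coe_real_pi, ENNReal.ofReal_coe_nnreal]
  simp

/-- Reverse comparison for functions whose Dirichlet density is small near the origin. -/
lemma ApIntPow_le_Gfun_add {α p : ℝ} (hα : -1 ≤ α) (hp : 2 < p) {g : ℂ → ℂ}
    (hg : DifferentiableOn ℂ g unitDisk) (hg0 : g 0 = 0) {r M : ℝ} (hr : 0 < r) (hM : 0 ≤ M)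
    (hsmall : ∀ z ∈ unitDisk, ‖z‖ ≤ r → ‖deriv g z‖ ^ 2 * ‖g z‖ ^ (p - 2) ≤ M * ‖z‖ ^ 2) :
    ApIntPow p (p / 2 * (α + 2) - 2) g ≤
      ENNReal.ofReal (1 / r ^ 2) * Gfun α p g + ENNReal.ofReal (p / (2 * (α + 2)) * M) := by
  have ha : 0 < α + 2 := by linarith
  have hp0 : 0 < p := by linarith
  have hpi := Real.pi_pos
  have hβ : -1 < p / 2 * (α + 2) - 2 := by nlinarith
  set c := p * (α + 2) / 2 with hc
  have hc0 : 0 < c := by positivity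
  set D : ℂ → ℝ := fun z => ‖deriv g z‖ ^ 2 * ‖g z‖ ^ (p - 2) with hD
  have hDnn : ∀ z, 0 ≤ D z := fun z => by positivity
  have key : ∀ z ∈ unitDisk, ENNReal.ofReal (D z) *
      radialTail (p / 2 * (α + 2) - 2 + 1) (Real.log ‖z‖) ≤
      ENNReal.ofReal (1 / (2 * c) * (1 / r ^ 2)) * ENNReal.ofReal (D z * (1 - ‖z‖ ^ 2) ^ c) +
        ENNReal.ofReal (1 / (2 * c) * M) := fun z hz => by
    have hx := one_sub_norm_sq_pos hz
    have h1 := radialTail_le (b := p / 2 * (α + 2) - 2 + 1) (by linarith) hz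
    rw [show p / 2 * (α + 2) - 2 + 1 + 1 = c by rw [hc]; ring] at h1
    refine (mul_le_mul' le_rfl h1).trans ?_
    rw [← ENNReal.ofReal_mul (hDnn z), ← ENNReal.ofReal_mul (by positivity),
      ← ENNReal.ofReal_add (by have := hDnn z; positivity) (by positivity)]
    refine ENNReal.ofReal_le_ofReal ?_
    have e : D z * ((1 - ‖z‖ ^ 2) ^ c / (2 * c * ‖z‖ ^ 2)) =
      1 / (2 * c) * (D z / ‖z‖ ^ 2 * (1 - ‖z‖ ^ 2) ^ c) := by field_simp
    rw [e, mul_assoc, ← mul_add]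
    gcongr
    have hxc : (1 - ‖z‖ ^ 2) ^ c ≤ 1 :=
      Real.rpow_le_one hx.le (by nlinarith [sq_nonneg ‖z‖]) hc0.le
    have hxc0 : 0 ≤ (1 - ‖z‖ ^ 2) ^ c := by positivity
    have hDz := hDnn z
    rcases le_or_gt ‖z‖ r with h | h
    · have h2 : D z / ‖z‖ ^ 2 ≤ M := div_le_of_le_mul₀ (by positivity) hM (hsmall z hz h)
      have h3 : 0 ≤ D z / ‖z‖ ^ 2 := by positivity
      have : 0 ≤ 1 / r ^ 2 * (D z * (1 - ‖z‖ ^ 2) ^ c) := by positivity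
      nlinarith
    · have h2 : D z / ‖z‖ ^ 2 ≤ 1 / r ^ 2 * D z := by
        rw [one_div_mul_eq_div]; gcongr
      nlinarith
  rw [ApIntPow_eq_hardyStein hp hβ hg, hg0, norm_zero, Real.zero_rpow hp0.ne',
    ENNReal.ofReal_zero, zero_add]
  refine (mul_le_mul' le_rfl (setLIntegral_mono' measurableSet_unitDisk key)).trans ?_
  rw [lintegral_add_right _ measurable_const, lintegral_const_mul' _ _ ENNReal.ofReal_ne_top,
    lintegral_const, Measure.restrict_apply_univ, volume_unitDisk, mul_add, Gfun,
    ENNReal.div_eq_inv_mul, ← ENNReal.ofReal_inv_of_pos hpi]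
  simp only [← mul_assoc]
  rw [← ENNReal.ofReal_mul (by positivity), ← ENNReal.ofReal_mul (by positivity),
    ← ENNReal.ofReal_mul (by positivity), ← ENNReal.ofReal_mul (by positivity),
    ← ENNReal.ofReal_mul (by positivity)]
  refine le_of_eq ?_
  congr 2
  · congr 1; rw [hc]; field_simp
  · rw [hc]; field_simp

lemma norm_deriv_pow_mul_le {h : ℂ → ℂ} {ρ r δ : ℝ} (hr : r < ρ) (hρ : ρ < 1)
    (hh : DifferentiableOn ℂ h unitDisk) (hδ : ∀ z, ‖z‖ ≤ ρ → ‖h z‖ ≤ δ) (m : ℕ) {z : ℂ}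
    (hz : ‖z‖ ≤ r) :
    ‖deriv (fun z => z ^ (m + 2) * h z) z‖ ≤ ‖z‖ * ((m + 2 + 1 / (ρ - r)) * δ) := by
  have hδ0 : 0 ≤ δ := (norm_nonneg _).trans (hδ z (by linarith))
  have hz1 : ‖z‖ < 1 := by linarith
  have hzD : z ∈ unitDisk := by simpa [unitDisk] using hz1
  have hd : HasDerivAt h (deriv h z) z :=
    (hh.differentiableAt (Metric.isOpen_ball.mem_nhds hzD)).hasDerivAt
  have hball : Metric.closedBall z (ρ - r) ⊆ Metric.closedBall 0 ρ := fun y hy => by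
    rw [mem_closedBall_zero_iff]
    rw [mem_closedBall_iff_norm] at hy
    calc ‖y‖ = ‖(y - z) + z‖ := by ring_nf
      _ ≤ ‖y - z‖ + ‖z‖ := norm_add_le _ _
      _ ≤ ρ := by linarith
  have hcauchy : ‖deriv h z‖ ≤ δ / (ρ - r) := by
    refine Complex.norm_deriv_le_of_forall_mem_sphere_norm_le (by linarith) ?_ fun y hy => ?_
    · refine DifferentiableOn.diffContOnCl (hh.mono ?_)
      exact (Metric.closure_ball_subset_closedBall.trans hball).trans
        (Metric.closedBall_subset_ball hρ)
    · exact hδ y (mem_closedBall_zero_iff.1 (hball (Metric.sphere_subset_closedBall hy)))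
  have hD := ((hasDerivAt_pow (m + 2) z).mul hd).deriv
  have e : (fun z => z ^ (m + 2) * h z) = (fun z => z ^ (m + 2)) * h := rfl
  rw [e, hD]
  have h1 : ‖z‖ ^ (m + 1) ≤ ‖z‖ := by
    rw [pow_succ]; exact mul_le_of_le_one_left (norm_nonneg _) (pow_le_one₀ (norm_nonneg _) hz1.le)
  have h2 : ‖z‖ ^ (m + 2) ≤ ‖z‖ := by
    rw [pow_succ]; exact mul_le_of_le_one_left (norm_nonneg _) (pow_le_one₀ (norm_nonneg _) hz1.le)
  have h3 : ‖h z‖ ≤ δ := hδ z (by linarith)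
  refine (norm_add_le _ _).trans ?_
  have e2 : m + 2 - 1 = m + 1 := by omega
  rw [e2, norm_mul, norm_mul, norm_mul, norm_pow, norm_pow]
  have e3 : ‖((m + 2 : ℕ) : ℂ)‖ = m + 2 := by
    rw [Complex.norm_natCast]; push_cast; ring
  rw [e3]
  calc _ ≤ (m + 2) * ‖z‖ * δ + ‖z‖ * (δ / (ρ - r)) := by gcongr
    _ = _ := by ring

lemma iteratedDeriv_pow_mul_eq_zero {h : ℂ → ℂ} (hh : DifferentiableOn ℂ h unitDisk) {m j : ℕ}
    (hj : j < m) : iteratedDeriv j (fun z => z ^ m * h z) 0 = 0 := by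
  have h0 : (0 : ℂ) ∈ unitDisk := by simp [unitDisk]
  have hA : AnalyticAt ℂ h 0 := hh.analyticAt (Metric.isOpen_ball.mem_nhds h0)
  have hg : AnalyticAt ℂ (fun z => z ^ m * h z) 0 := (analyticAt_id.pow m).mul hA
  have : (m : ℕ∞) ≤ analyticOrderAt (fun z => z ^ m * h z) 0 := by
    rw [natCast_le_analyticOrderAt hg]
    exact ⟨h, hA, Eventually.of_forall fun z => by simp⟩
  exact (natCast_le_analyticOrderAt_iff_iteratedDeriv_eq_zero hg).1 this j hj

lemma norm_deriv_sq_mul_norm_rpow_le {h : ℂ → ℂ} {ρ r δ p : ℝ} (hp : 2 < p) (hr : r < ρ)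
    (hρ : ρ < 1) (hh : DifferentiableOn ℂ h unitDisk) (hδ0 : 0 ≤ δ)
    (hδ : ∀ z, ‖z‖ ≤ ρ → ‖h z‖ ≤ δ) (m : ℕ) {z : ℂ} (hz : ‖z‖ ≤ r) :
    ‖deriv (fun z => z ^ (m + 2) * h z) z‖ ^ 2 * ‖z ^ (m + 2) * h z‖ ^ (p - 2) ≤
      (m + 2 + 1 / (ρ - r)) ^ 2 * δ ^ p * ‖z‖ ^ 2 := by
  have h1 := norm_deriv_pow_mul_le hr hρ hh hδ m hz
  have hz1 : ‖z‖ < 1 := by linarith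
  have h2 : ‖z ^ (m + 2) * h z‖ ≤ δ := by
    rw [norm_mul, norm_pow]
    exact (mul_le_of_le_one_left (norm_nonneg _) (pow_le_one₀ (norm_nonneg _) hz1.le)).trans
      (hδ z (by linarith))
  have hρr : 0 < ρ - r := by linarith
  have hp2 : 0 < p - 2 := by linarith
  have e : δ ^ p = δ ^ 2 * δ ^ (p - 2) := by
    rw [← Real.rpow_two, ← Real.rpow_add' hδ0 (by linarith)]
    congr 1; ring
  calc _ ≤ (‖z‖ * ((m + 2 + 1 / (ρ - r)) * δ)) ^ 2 * δ ^ (p - 2) := by gcongr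
    _ = _ := by rw [e]; ring

/-- The main estimate for one disk automorphism: the function transported towards the boundary
and multiplied by a power of `z` almost retains its Bergman norm. -/
lemma rpow_mul_ApIntPow_le {α p : ℝ} (hα : -1 ≤ α) (hp : 2 < p) {f : ℂ → ℂ}
    (hf : DifferentiableOn ℂ f unitDisk) (hfn : A2normSq α f ≤ 1) (n : ℕ) {S : ℝ≥0∞}
    (hS : ∀ g : ℂ → ℂ, DifferentiableOn ℂ g unitDisk → A2normSq α g ≤ 1 →
      (∀ j ≤ n, iteratedDeriv j g 0 = 0) → Gfun α p g ≤ S)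
    {w : ℝ} (h0 : 0 ≤ w) (h1 : w < 1) {r ρ δ : ℝ} (hr0 : 0 < r) (hr : r < ρ) (hρ : ρ < 1)
    (hδ0 : 0 ≤ δ) (hδ : ∀ z, ‖z‖ ≤ ρ → ‖mobiusTransport (α + 2) w f z‖ ≤ δ) :
    ENNReal.ofReal (r ^ ((n + 2) * p)) * ApIntPow p (p / 2 * (α + 2) - 2) f ≤
      ENNReal.ofReal (1 / r ^ 2) * S +
        ENNReal.ofReal ((p / (2 * (α + 2)) * (n + 2 + 1 / (ρ - r)) ^ 2 + 1) * δ ^ p) := by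
  have ha : 0 < α + 2 := by linarith
  have hp0 : 0 < p := by linarith
  have hβ : -1 < p / 2 * (α + 2) - 2 := by nlinarith
  set h := mobiusTransport (α + 2) w f with hh
  have hd : DifferentiableOn ℂ h unitDisk := differentiableOn_mobiusTransport h0 h1 hf
  set g : ℂ → ℂ := fun z => z ^ (n + 2) * h z with hg
  have hgd : DifferentiableOn ℂ g unitDisk := (by fun_prop : Differentiable ℂ fun z : ℂ =>
    z ^ (n + 2)).differentiableOn.mul hd
  have hgle : ∀ z ∈ unitDisk, ‖g z‖ ≤ ‖h z‖ := fun z hz => by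
    rw [hg, norm_mul, norm_pow]
    exact mul_le_of_le_one_left (norm_nonneg _)
      (pow_le_one₀ (norm_nonneg _) (norm_lt_one_of_mem_unitDisk hz).le)
  have hgS : Gfun α p g ≤ S := hS g hgd
    ((A2normSq_le_of_norm_le_mobiusTransport hα h0 h1 hf hgd hgle).trans hfn)
    fun j hj => iteratedDeriv_pow_mul_eq_zero hd (by omega)
  have hAg := ApIntPow_le_Gfun_add (M := (n + 2 + 1 / (ρ - r)) ^ 2 * δ ^ p) hα hp hgd
    (by simp [hg]) hr0 (by positivity)
    fun z _ hz => norm_deriv_sq_mul_norm_rpow_le hp hr hρ hd hδ0 hδ n hz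
  have hAf : ApIntPow p (p / 2 * (α + 2) - 2) f = ApIntPow p (p / 2 * (α + 2) - 2) h :=
    (ApIntPow_mobiusTransport h0 h1 p _ (by ring)).symm
  have hmeas : Measurable (unitDisk.indicator fun z => ENNReal.ofReal
      ((1 - ‖z‖ ^ 2) ^ (p / 2 * (α + 2) - 2) * ‖g z‖ ^ p)) := by
    refine measurable_indicator_of_continuousOn measurableSet_unitDisk
      (ENNReal.continuous_ofReal.comp_continuousOn (ContinuousOn.mul ?_ ?_))
    · exact ContinuousOn.rpow_const (by fun_prop) fun z hz => Or.inl (one_sub_norm_sq_pos hz).ne'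
    · exact hgd.continuousOn.norm.rpow_const fun _ _ => Or.inr hp0.le
  have hsplit : ENNReal.ofReal (r ^ ((n + 2) * p)) * ApIntPow p (p / 2 * (α + 2) - 2) h ≤
      ApIntPow p (p / 2 * (α + 2) - 2) g + ENNReal.ofReal (δ ^ p) := by
    have hone := ApIntPow_one hp hβ
    rw [← mul_one (ENNReal.ofReal (δ ^ p)), ← hone]
    simp only [ApIntPow]
    rw [← mul_div_assoc, ← mul_div_assoc, ← ENNReal.add_div, mul_left_comm,
      mul_left_comm (ENNReal.ofReal (δ ^ p)), ← mul_add]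
    refine ENNReal.div_le_div_right (mul_le_mul' le_rfl ?_) _
    rw [← lintegral_const_mul' _ _ ENNReal.ofReal_ne_top,
      ← lintegral_const_mul' _ _ ENNReal.ofReal_ne_top, ← lintegral_indicator
        measurableSet_unitDisk, ← lintegral_indicator measurableSet_unitDisk,
        ← lintegral_indicator measurableSet_unitDisk, ← lintegral_add_left hmeas]
    refine lintegral_mono fun z => ?_
    by_cases hz : z ∈ unitDisk
    swap
    · simp [hz]
    simp only [indicator_of_mem hz]
    have hx := one_sub_norm_sq_pos hz
    rw [← ENNReal.ofReal_mul (by positivity), ← ENNReal.ofReal_mul (by positivity),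
      ← ENNReal.ofReal_add (by positivity) (by positivity)]
    refine ENNReal.ofReal_le_ofReal ?_
    have hpt : r ^ ((n + 2) * p) * ‖h z‖ ^ p ≤ ‖g z‖ ^ p + δ ^ p := by
      rcases le_or_gt ‖z‖ r with hzr | hzr
      · have e1 : ‖h z‖ ^ p ≤ δ ^ p := by
          gcongr; exact hδ z (by linarith)
        have e2 : r ^ ((n + 2) * p) ≤ 1 := Real.rpow_le_one hr0.le (by linarith) (by positivity)
        have e3 : 0 ≤ ‖g z‖ ^ p := by positivity
        have e4 : r ^ ((n + 2) * p) * ‖h z‖ ^ p ≤ ‖h z‖ ^ p :=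
          mul_le_of_le_one_left (by positivity) e2
        linarith
      · have e1 : ‖g z‖ ^ p = ‖z‖ ^ ((n + 2) * p) * ‖h z‖ ^ p := by
          rw [hg, norm_mul, norm_pow, Real.mul_rpow (by positivity) (norm_nonneg _),
            ← Real.rpow_natCast_mul (norm_nonneg _)]
          push_cast; rfl
        rw [e1]
        have e2 : r ^ ((n + 2) * p) ≤ ‖z‖ ^ ((n + 2) * p) := by gcongr
        have e3 : 0 ≤ δ ^ p := by positivity
        nlinarith [Real.rpow_nonneg (norm_nonneg (h z)) p]
    rw [norm_one, Real.one_rpow]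
    have hxc : 0 ≤ (1 - ‖z‖ ^ 2) ^ (p / 2 * (α + 2) - 2) := by positivity
    nlinarith
  rw [hAf]
  refine hsplit.trans ?_
  have e : (p / (2 * (α + 2)) * (n + 2 + 1 / (ρ - r)) ^ 2 + 1) * δ ^ p =
    p / (2 * (α + 2)) * ((n + 2 + 1 / (ρ - r)) ^ 2 * δ ^ p) + δ ^ p := by ring
  rw [e, ENNReal.ofReal_add (by positivity) (by positivity), ← add_assoc]
  gcongr
  exact hAg.trans (by gcongr)

lemma ApIntPow_le_of_bounded {α p : ℝ} (hα : -1 ≤ α) (hp : 2 < p) {f : ℂ → ℂ}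
    (hf : DifferentiableOn ℂ f unitDisk) (hfn : A2normSq α f ≤ 1) {C : ℝ}
    (hC : ∀ z ∈ unitDisk, ‖f z‖ ≤ C) (n : ℕ) {S : ℝ≥0∞}
    (hS : ∀ g : ℂ → ℂ, DifferentiableOn ℂ g unitDisk → A2normSq α g ≤ 1 →
      (∀ j ≤ n, iteratedDeriv j g 0 = 0) → Gfun α p g ≤ S) :
    ApIntPow p (p / 2 * (α + 2) - 2) f ≤ S := by
  have ha : 0 < α + 2 := by linarith
  have hp0 : 0 < p := by linarith
  have hC0 : 0 ≤ C := (norm_nonneg _).trans (hC 0 (by simp [unitDisk]))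
  have hr : ∀ r ∈ Ioo (0 : ℝ) 1,
      ENNReal.ofReal (r ^ ((n + 2) * p)) * ApIntPow p (p / 2 * (α + 2) - 2) f ≤
        ENNReal.ofReal (1 / r ^ 2) * S := fun r hr => by
    obtain ⟨ρ, hrρ, hρ⟩ := exists_between hr.2
    have hρ1 : 0 < 1 - ρ := by linarith
    set δ : ℝ → ℝ := fun w => ((1 - w ^ 2) / (1 - ρ) ^ 2) ^ ((α + 2) / 2) * C with hδ
    have hlim : Tendsto (fun w => ENNReal.ofReal (1 / r ^ 2) * S +
        ENNReal.ofReal ((p / (2 * (α + 2)) * (n + 2 + 1 / (ρ - r)) ^ 2 + 1) * δ w ^ p)) (𝓝[<] 1)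
        (𝓝 (ENNReal.ofReal (1 / r ^ 2) * S + 0)) := by
      refine tendsto_const_nhds.add ?_
      have hcont : Continuous fun w =>
          (p / (2 * (α + 2)) * (n + 2 + 1 / (ρ - r)) ^ 2 + 1) * δ w ^ p := by
        refine continuous_const.mul (Continuous.rpow_const ?_ fun _ => Or.inr hp0.le)
        refine Continuous.mul (Continuous.rpow_const (by fun_prop) fun _ => Or.inr ?_)
          continuous_const
        positivity
      have := ((ENNReal.continuous_ofReal.comp hcont).tendsto 1).mono_left
        (nhdsWithin_le_nhds (s := Iio 1))
      have h2 : (α + 2) / 2 ≠ 0 := by positivity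
      simpa [Function.comp_def, hδ, Real.zero_rpow h2, Real.zero_rpow hp0.ne'] using this
    rw [add_zero] at hlim
    refine ge_of_tendsto hlim ?_
    filter_upwards [Ioo_mem_nhdsLT (zero_lt_one (α := ℝ))] with w hw
    have hw2 := one_sub_sq_pos hw.1.le hw.2
    refine rpow_mul_ApIntPow_le hα hp hf hfn n hS hw.1.le hw.2 hr.1 hrρ hρ (by positivity) ?_
    intro z hz
    have hzD : z ∈ unitDisk := by
      rw [unitDisk, mem_ball_zero_iff]; linarith
    have hJ := diskInvolutionFactor_pos hw.1.le hw.2 hzD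
    rw [norm_mobiusTransport hw.1.le hw.2 z]
    simp only [hδ]
    gcongr
    · exact diskInvolutionFactor_le hw.1.le hw.2 hρ hz
    · exact hC _ (diskInvolution_mem hw.1.le hw.2 hzD)
  have hL : Tendsto (fun r : ℝ => ENNReal.ofReal (r ^ ((n + 2) * p)) *
      ApIntPow p (p / 2 * (α + 2) - 2) f) (𝓝[<] 1)
      (𝓝 (ENNReal.ofReal 1 * ApIntPow p (p / 2 * (α + 2) - 2) f)) := by
    refine ENNReal.Tendsto.mul_const ?_ (Or.inl (by simp))
    refine (ENNReal.continuous_ofReal.tendsto _).comp ?_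
    have : ContinuousAt (fun r : ℝ => r ^ ((n + 2) * p)) 1 :=
      Real.continuousAt_rpow_const _ _ (Or.inl one_ne_zero)
    simpa using this.tendsto.mono_left (nhdsWithin_le_nhds (s := Iio 1))
  have hR : Tendsto (fun r : ℝ => ENNReal.ofReal (1 / r ^ 2) * S) (𝓝[<] 1)
      (𝓝 (ENNReal.ofReal 1 * S)) := by
    refine ENNReal.Tendsto.mul_const ?_ (Or.inl (by simp))
    refine (ENNReal.continuous_ofReal.tendsto _).comp ?_
    have : ContinuousAt (fun r : ℝ => 1 / r ^ 2) 1 := by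
      refine continuousAt_const.div (by fun_prop) (by norm_num)
    simpa using this.tendsto.mono_left (nhdsWithin_le_nhds (s := Iio 1))
  rw [ENNReal.ofReal_one, one_mul] at hL hR
  refine le_of_tendsto_of_tendsto hL hR ?_
  filter_upwards [Ioo_mem_nhdsLT (zero_lt_one (α := ℝ))] with r hr' using hr r hr'

lemma iteratedDeriv_dilate (t : ℂ) (f : ℂ → ℂ) (j : ℕ) :
    iteratedDeriv j (fun z => f (t * z)) = fun z => t ^ j * iteratedDeriv j f (t * z) := by
  induction j with
  | zero => simp
  | succ j ih =>
    rw [iteratedDeriv_succ, ih]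
    ext z
    rw [deriv_const_mul_field, deriv_comp_mul_left t (iteratedDeriv j f) z, smul_eq_mul,
      iteratedDeriv_succ]
    ring

lemma A2normSq_dilate_le {α t : ℝ} (hα : -1 ≤ α) (ht0 : 0 ≤ t) (ht1 : t ≤ 1) (f : ℂ → ℂ) :
    A2normSq α (fun z => f (t * z)) ≤ A2normSq α f := by
  refine ENNReal.tsum_le_tsum fun n => ENNReal.ofReal_le_ofReal ?_
  have hc := ccoef_pos (b := α + 2) (by linarith) n
  have : ‖taylorCoeff (fun z => f (t * z)) n‖ ≤ ‖taylorCoeff f n‖ := by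
    rw [taylorCoeff, taylorCoeff, iteratedDeriv_dilate]
    beta_reduce
    rw [mul_zero, mul_div_assoc, norm_mul,
      norm_pow, Complex.norm_real, Real.norm_of_nonneg ht0]
    exact mul_le_of_le_one_left (norm_nonneg _) (pow_le_one₀ ht0 ht1)
  gcongr

lemma mul_mem_unitDisk {t : ℝ} (ht0 : 0 ≤ t) (ht1 : t ≤ 1) {z : ℂ} (hz : z ∈ unitDisk) :
    (t : ℂ) * z ∈ unitDisk := by
  rw [unitDisk, mem_ball_zero_iff] at hz ⊢
  rw [norm_mul, Complex.norm_real, Real.norm_of_nonneg ht0]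
  exact (mul_le_of_le_one_left (norm_nonneg _) ht1).trans_lt hz

lemma differentiableOn_dilate {t : ℝ} (ht0 : 0 ≤ t) (ht1 : t ≤ 1) {f : ℂ → ℂ}
    (hf : DifferentiableOn ℂ f unitDisk) : DifferentiableOn ℂ (fun z => f (t * z)) unitDisk :=
  hf.comp (by fun_prop) fun _ hz => mul_mem_unitDisk ht0 ht1 hz

lemma ApIntPow_le_of_forall_dilate {p β : ℝ} (hp : 0 < p) {f : ℂ → ℂ}
    (hf : DifferentiableOn ℂ f unitDisk) {S : ℝ≥0∞}
    (h : ∀ t ∈ Ioo (0 : ℝ) 1, ApIntPow p β (fun z => f (t * z)) ≤ S) :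
    ApIntPow p β f ≤ S := by
  have hpi := Real.pi_pos
  obtain ⟨t, -, htI, ht⟩ := exists_seq_strictMono_tendsto' (zero_lt_one (α := ℝ))
  set c : ℝ≥0∞ := ENNReal.ofReal (β + 1) / ENNReal.ofReal Real.pi with hc
  have hctop : c ≠ ⊤ :=
    ENNReal.div_ne_top ENNReal.ofReal_ne_top (by simpa using hpi)
  have hA : ∀ g : ℂ → ℂ, ApIntPow p β g = ∫⁻ z, unitDisk.indicator
      (fun z => c * ENNReal.ofReal ((1 - ‖z‖ ^ 2) ^ β * ‖g z‖ ^ p)) z := fun g => by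
    rw [lintegral_indicator measurableSet_unitDisk, lintegral_const_mul' _ _ hctop, ApIntPow, hc,
      div_eq_mul_inv, div_eq_mul_inv, mul_right_comm]
  have hcont : ∀ g : ℂ → ℂ, DifferentiableOn ℂ g unitDisk → ContinuousOn
      (fun z => c * ENNReal.ofReal ((1 - ‖z‖ ^ 2) ^ β * ‖g z‖ ^ p)) unitDisk := fun g hg => by
    refine (ENNReal.continuous_const_mul hctop).comp_continuousOn
      (ENNReal.continuous_ofReal.comp_continuousOn (ContinuousOn.mul ?_ ?_))
    · exact ContinuousOn.rpow_const (by fun_prop) fun z hz => Or.inl (one_sub_norm_sq_pos hz).ne'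
    · exact hg.continuousOn.norm.rpow_const fun _ _ => Or.inr hp.le
  rw [hA f]
  calc ∫⁻ z, unitDisk.indicator (fun z => c * ENNReal.ofReal ((1 - ‖z‖ ^ 2) ^ β * ‖f z‖ ^ p)) z
      = ∫⁻ z, liminf (fun k => unitDisk.indicator
          (fun z => c * ENNReal.ofReal ((1 - ‖z‖ ^ 2) ^ β * ‖f (t k * z)‖ ^ p)) z) atTop := by
        refine lintegral_congr fun z => (Tendsto.liminf_eq ?_).symm
        by_cases hz : z ∈ unitDisk
        · simp only [indicator_of_mem hz]
          refine ((ENNReal.continuous_const_mul hctop).tendsto _).comp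
            ((ENNReal.continuous_ofReal.tendsto _).comp (Tendsto.const_mul _ ?_))
          have hfz : ContinuousAt f z :=
            hf.continuousOn.continuousAt (Metric.isOpen_ball.mem_nhds hz)
          have htz : Tendsto (fun k => (t k : ℂ) * z) atTop (𝓝 z) := by
            have h1 := ((Complex.continuous_ofReal.tendsto 1).comp ht).mul_const z
            simpa using h1
          exact ((hfz.tendsto.comp htz).norm).rpow_const (Or.inr hp.le)
        · simp only [indicator_of_notMem hz]
          exact tendsto_const_nhds
    _ ≤ liminf (fun k => ∫⁻ z, unitDisk.indicator
          (fun z => c * ENNReal.ofReal ((1 - ‖z‖ ^ 2) ^ β * ‖f (t k * z)‖ ^ p)) z) atTop :=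
        lintegral_liminf_le fun k => measurable_indicator_of_continuousOn measurableSet_unitDisk
          (hcont _ (differentiableOn_dilate (htI k).1.le (htI k).2.le hf))
    _ ≤ S := by
        refine liminf_le_of_frequently_le' (Frequently.of_forall fun k => ?_)
        rw [← hA fun z => f (t k * z)]
        exact h _ (htI k)

lemma ApIntPow_le {α p : ℝ} (hα : -1 ≤ α) (hp : 2 < p) {f : ℂ → ℂ}
    (hf : DifferentiableOn ℂ f unitDisk) (hfn : A2normSq α f ≤ 1) (n : ℕ) {S : ℝ≥0∞}
    (hS : ∀ g : ℂ → ℂ, DifferentiableOn ℂ g unitDisk → A2normSq α g ≤ 1 →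
      (∀ j ≤ n, iteratedDeriv j g 0 = 0) → Gfun α p g ≤ S) :
    ApIntPow p (p / 2 * (α + 2) - 2) f ≤ S := by
  refine ApIntPow_le_of_forall_dilate (by linarith) hf fun t ht => ?_
  have hsub : Metric.closedBall (0 : ℂ) t ⊆ unitDisk := Metric.closedBall_subset_ball ht.2
  obtain ⟨C, hC⟩ := (isCompact_closedBall (0 : ℂ) t).exists_bound_of_continuousOn
    (hf.continuousOn.mono hsub)
  refine ApIntPow_le_of_bounded hα hp (differentiableOn_dilate ht.1.le ht.2.le hf)
    ((A2normSq_dilate_le hα ht.1.le ht.2.le f).trans hfn) (fun z hz => hC _ ?_) n hS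
  rw [mem_closedBall_zero_iff, norm_mul, Complex.norm_real, Real.norm_of_nonneg ht.1.le]
  exact mul_le_of_le_one_right ht.1.le (norm_lt_one_of_mem_unitDisk hz).le

lemma A2norm_le_one_iff {α : ℝ} {f : ℂ → ℂ} : A2norm α f ≤ 1 ↔ A2normSq α f ≤ 1 := by
  rw [A2norm, ← ENNReal.rpow_le_rpow_iff (x := A2normSq α f) (y := 1) (z := 1 / 2) (by norm_num),
    ENNReal.one_rpow]

/-- For α ≥ -1, p > 2 and n ≥ 0, the three suprema (i), (ii), (iii)
coincide. -/
theorem statement2 (α p : ℝ) (n : ℕ) (hα : -1 ≤ α) (hp : 2 < p) :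
    sSup {x : ℝ≥0∞ | ∃ f : ℂ → ℂ, DifferentiableOn ℂ f unitDisk ∧
        A2norm α f ≤ 1 ∧ x = ApNorm p (p / 2 * (α + 2) - 2) f} =
      sSup {x : ℝ≥0∞ | ∃ f : ℂ → ℂ, DifferentiableOn ℂ f unitDisk ∧
        A2norm α f ≤ 1 ∧ x = Ffun α p f ^ (1 / p)} ∧
    sSup {x : ℝ≥0∞ | ∃ f : ℂ → ℂ, DifferentiableOn ℂ f unitDisk ∧
        A2norm α f ≤ 1 ∧ x = Ffun α p f ^ (1 / p)} =
      sSup {x : ℝ≥0∞ | ∃ f : ℂ → ℂ, DifferentiableOn ℂ f unitDisk ∧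
        A2norm α f ≤ 1 ∧ (∀ j ≤ n, iteratedDeriv j f 0 = 0) ∧
        x = Gfun α p f ^ (1 / p)} := by
  have hp0 : 0 < p := by linarith
  have h1p : 0 ≤ 1 / p := by positivity
  set I := sSup {x : ℝ≥0∞ | ∃ f : ℂ → ℂ, DifferentiableOn ℂ f unitDisk ∧
    A2norm α f ≤ 1 ∧ x = ApNorm p (p / 2 * (α + 2) - 2) f} with hI
  set J := sSup {x : ℝ≥0∞ | ∃ f : ℂ → ℂ, DifferentiableOn ℂ f unitDisk ∧
    A2norm α f ≤ 1 ∧ x = Ffun α p f ^ (1 / p)} with hJ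
  set K := sSup {x : ℝ≥0∞ | ∃ f : ℂ → ℂ, DifferentiableOn ℂ f unitDisk ∧
    A2norm α f ≤ 1 ∧ (∀ j ≤ n, iteratedDeriv j f 0 = 0) ∧ x = Gfun α p f ^ (1 / p)} with hK
  have hKJ : K ≤ J := by
    refine sSup_le ?_
    rintro _ ⟨f, hf, hfn, -, rfl⟩
    exact le_sSup_of_le ⟨f, hf, hfn, rfl⟩ (ENNReal.rpow_le_rpow (Gfun_le_Ffun hα hp f) h1p)
  have hJI : J ≤ I := by
    refine sSup_le ?_
    rintro _ ⟨f, hf, hfn, rfl⟩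
    exact le_sSup_of_le ⟨f, hf, hfn, rfl⟩ (ENNReal.rpow_le_rpow (Ffun_le_ApIntPow hα hp hf) h1p)
  have hIK : I ≤ K := by
    refine sSup_le ?_
    rintro _ ⟨f, hf, hfn, rfl⟩
    rw [ApNorm, one_div, ENNReal.rpow_inv_le_iff hp0]
    refine ApIntPow_le hα hp hf (A2norm_le_one_iff.1 hfn) n fun g hg hgn hg0 => ?_
    rw [← ENNReal.rpow_inv_le_iff hp0, ← one_div]
    exact le_sSup ⟨g, hg, A2norm_le_one_iff.2 hgn, hg0, rfl⟩
  exact ⟨le_antisymm (hIK.trans hKJ) hJI, le_antisymm (hJI.trans hIK) hKJ⟩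

end
end

section
/- Let α ≥ -1 and p > 2. If f is holomorphic on 𝔻 with ‖f‖_{A²_α} = 1 and |f(0)| = sup_{z ∈ 𝔻} |f(z)| (1−|z|²)^{(α+2)/2}, then F_p(f) ≤ 1. Moreover, F_p(f) = 1 if and only if f is constant. -/
open MeasureTheory Set Filter
open scoped ENNReal NNReal Topology

noncomputable section

/-- Parseval's identity for polynomials on a circle of radius `r`, with `[-π, π]` as the range of
angles. -/
lemma lintegral_norm_sq_sum_polar (b : ℕ → ℂ) (r : ℝ) (N : ℕ) :
    ∫⁻ θ in Ioo (-Real.pi) Real.pi, ENNReal.ofReal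
      (‖∑ n ∈ Finset.range N, b n * (Complex.polarCoord.symm (r, θ)) ^ n‖ ^ 2) =
    ENNReal.ofReal (2 * Real.pi * ∑ n ∈ Finset.range N, ‖b n‖ ^ 2 * (r ^ 2) ^ n) := by
  set P : Polynomial ℂ := ∑ n ∈ Finset.range N, Polynomial.monomial n (b n * r ^ n) with hP
  have hcoeff (n : ℕ) : P.coeff n = if n < N then b n * r ^ n else 0 := by
    simp [hP, Polynomial.finsetSum_coeff, Polynomial.coeff_monomial]
  have hsum : ∑ n ∈ P.support, ‖P.coeff n‖ ^ 2 =
      ∑ n ∈ Finset.range N, ‖b n‖ ^ 2 * (r ^ 2) ^ n := by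
    rw [Finset.sum_subset (s₂ := Finset.range N)]
    · refine Finset.sum_congr rfl fun n hn ↦ ?_
      rw [hcoeff, if_pos (Finset.mem_range.mp hn), norm_mul, norm_pow, mul_pow,
        Complex.norm_real, ← pow_mul, mul_comm n 2, pow_mul, Real.norm_eq_abs, sq_abs]
    · intro n hn
      by_contra h
      simp_all
    · intro n _ hn
      simpa using hn
  have heval (θ : ℝ) : ∑ n ∈ Finset.range N, b n * (Complex.polarCoord.symm (r, θ)) ^ n =
      P.eval (circleMap 0 1 θ) := by
    simp only [hP, Polynomial.eval_finsetSum, Polynomial.eval_monomial,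
      Complex.polarCoord_symm_apply, circleMap, Complex.exp_mul_I]
    refine Finset.sum_congr rfl fun n _ ↦ ?_
    push_cast
    rw [mul_pow]
    ring
  have hcont : Continuous fun θ : ℝ ↦ ‖P.eval (circleMap 0 1 θ)‖ ^ 2 := by fun_prop
  have hper : Function.Periodic (fun θ : ℝ ↦ ‖P.eval (circleMap 0 1 θ)‖ ^ 2) (2 * Real.pi) := by
    intro θ
    simp only [periodic_circleMap 0 1 θ]
  simp_rw [heval]
  rw [← ofReal_integral_eq_lintegral_ofReal]
  · rw [← hsum, Polynomial.sum_sq_norm_coeff_eq_circleAverage, Real.circleAverage_def,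
      ← integral_Ioc_eq_integral_Ioo, ← intervalIntegral.integral_of_le (by linarith [Real.pi_pos])]
    have := hper.intervalIntegral_add_eq (-Real.pi) 0
    rw [zero_add, show -Real.pi + 2 * Real.pi = Real.pi by ring] at this
    rw [this, smul_eq_mul, mul_inv_cancel_left₀ (by positivity)]
  · exact (hcont.integrableOn_Icc (a := -Real.pi) (b := Real.pi)).mono_set Ioo_subset_Icc_self
  · exact .of_forall fun θ ↦ by positivity

lemma lintegral_norm_sq_polar_le {g : ℂ → ℂ} {b : ℕ → ℂ}
    (hg : ∀ z ∈ unitDisk, HasSum (fun n ↦ b n * z ^ n) (g z)) {r : ℝ} (hr : r ∈ Ioo (0 : ℝ) 1) :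
    ∫⁻ θ in Ioo (-Real.pi) Real.pi,
      ENNReal.ofReal (‖g (Complex.polarCoord.symm (r, θ))‖ ^ 2) ≤
    ∑' n, ENNReal.ofReal (2 * Real.pi * (‖b n‖ ^ 2 * (r ^ 2) ^ n)) := by
  set S : ℕ → ℝ → ℝ≥0∞ := fun N θ ↦ ENNReal.ofReal
    (‖∑ n ∈ Finset.range N, b n * (Complex.polarCoord.symm (r, θ)) ^ n‖ ^ 2) with hS
  have hlim (θ : ℝ) : ENNReal.ofReal (‖g (Complex.polarCoord.symm (r, θ))‖ ^ 2) =
      liminf (fun N ↦ S N θ) atTop := by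
    have hz : Complex.polarCoord.symm (r, θ) ∈ unitDisk := by
      rw [unitDisk, mem_ball_zero_iff, Complex.norm_polarCoord_symm, abs_of_pos hr.1]
      exact hr.2
    exact (ENNReal.tendsto_ofReal ((hg _ hz).tendsto_sum_nat.norm.pow 2)).liminf_eq.symm
  have hmeas (N : ℕ) : Measurable (S N) := by
    simp only [hS, Complex.polarCoord_symm_apply]
    fun_prop
  simp_rw [hlim]
  refine (lintegral_liminf_le hmeas).trans (liminf_le_of_le (by isBoundedDefault) ?_)
  intro c hc
  obtain ⟨N, hN⟩ := hc.exists
  refine hN.trans ?_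
  rw [hS, lintegral_norm_sq_sum_polar, Finset.mul_sum,
    ENNReal.ofReal_sum_of_nonneg fun n _ ↦ by positivity]
  exact ENNReal.sum_le_tsum _

/-- One half of Parseval's identity on the unit disk, with a radial weight. -/
lemma lintegral_unitDisk_radial_le {g : ℂ → ℂ} {b : ℕ → ℂ} (hgm : Measurable g)
    (hg : ∀ z ∈ unitDisk, HasSum (fun n ↦ b n * z ^ n) (g z)) {W : ℝ → ℝ≥0∞} (hW : Measurable W) :
    ∫⁻ z in unitDisk, ENNReal.ofReal (‖g z‖ ^ 2) * W ‖z‖ ≤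
    ∑' n, ENNReal.ofReal (2 * Real.pi * ‖b n‖ ^ 2) *
      ∫⁻ r in Ioo (0 : ℝ) 1, ENNReal.ofReal (r ^ (2 * n + 1)) * W r := by
  have hsymm : Measurable (Complex.polarCoord.symm : ℝ × ℝ → ℂ) := by
    have : (Complex.polarCoord.symm : ℝ × ℝ → ℂ) =
        fun p ↦ p.1 * (Real.cos p.2 + Real.sin p.2 * Complex.I) :=
      funext Complex.polarCoord_symm_apply
    rw [this]
    fun_prop
  have hdisk : MeasurableSet unitDisk := measurableSet_ball
  have hh : Measurable (unitDisk.indicator fun z ↦ ENNReal.ofReal (‖g z‖ ^ 2) * W ‖z‖) :=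
    Measurable.indicator (by fun_prop) hdisk
  rw [← lintegral_indicator hdisk, ← Complex.lintegral_comp_polarCoord_symm,
    show polarCoord.target = Ioi (0 : ℝ) ×ˢ Ioo (-Real.pi) Real.pi from rfl,
    Measure.volume_eq_prod, setLIntegral_prod]
  swap
  · simp only [smul_eq_mul]
    exact ((by fun_prop : Measurable fun p : ℝ × ℝ ↦ ENNReal.ofReal p.1).mul
      (hh.comp hsymm)).aemeasurable
  calc
    _ ≤ ∫⁻ r in Ioi (0 : ℝ), (Ioo (0 : ℝ) 1).indicator (fun r ↦ ∑' n,
        ENNReal.ofReal (2 * Real.pi * ‖b n‖ ^ 2) *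
          (ENNReal.ofReal (r ^ (2 * n + 1)) * W r)) r := by
      refine setLIntegral_mono' measurableSet_Ioi fun r (hr : 0 < r) ↦ ?_
      have hnorm (θ : ℝ) : ‖Complex.polarCoord.symm (r, θ)‖ = r := by
        rw [Complex.norm_polarCoord_symm, abs_of_pos hr]
      by_cases hr1 : r < 1
      · have hmem (θ : ℝ) : Complex.polarCoord.symm (r, θ) ∈ unitDisk := by
          rwa [unitDisk, mem_ball_zero_iff, hnorm]
        simp only [indicator_of_mem (hmem _), hnorm, smul_eq_mul,
          indicator_of_mem (show r ∈ Ioo (0 : ℝ) 1 from ⟨hr, hr1⟩)]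
        rw [lintegral_const_mul _ (by fun_prop), lintegral_mul_const _ (by fun_prop)]
        calc
          _ ≤ ENNReal.ofReal r *
              ((∑' n, ENNReal.ofReal (2 * Real.pi * (‖b n‖ ^ 2 * (r ^ 2) ^ n))) * W r) := by
            gcongr
            exact lintegral_norm_sq_polar_le hg ⟨hr, hr1⟩
          _ = _ := by
            rw [← ENNReal.tsum_mul_right, ← ENNReal.tsum_mul_left]
            congr 1 with n
            rw [← mul_assoc, ← ENNReal.ofReal_mul hr.le,
              ← mul_assoc (ENNReal.ofReal (2 * Real.pi * ‖b n‖ ^ 2)),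
              ← ENNReal.ofReal_mul (by positivity)]
            ring_nf
      · have hmem (θ : ℝ) : Complex.polarCoord.symm (r, θ) ∉ unitDisk := by
          rwa [unitDisk, mem_ball_zero_iff, hnorm]
        simp only [indicator_of_notMem (hmem _), smul_zero, lintegral_zero, zero_le]
    _ = _ := by
      rw [lintegral_indicator measurableSet_Ioo, Measure.restrict_restrict measurableSet_Ioo,
        inter_eq_left.mpr Ioo_subset_Ioi_self, lintegral_tsum fun n ↦ by fun_prop]
      congr 1 with n
      rw [lintegral_const_mul _ (by fun_prop)]

/-- The radial weight `(1-r²)^{α+2} ∫₀¹ s^{α+1}/(1-(1-r²)s) ds`. -/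
def radialWeight (α r : ℝ) : ℝ≥0∞ :=
  ENNReal.ofReal ((1 - r ^ 2) ^ (α + 2)) *
    ∫⁻ s in Ioo (0 : ℝ) 1, ENNReal.ofReal (s ^ (α + 1) / (1 - (1 - r ^ 2) * s))

lemma measurable_radialWeight_s4 (α : ℝ) : Measurable (radialWeight α) := by
  have h : Measurable (Function.uncurry fun r s : ℝ ↦
      ENNReal.ofReal (s ^ (α + 1) / (1 - (1 - r ^ 2) * s))) := by
    unfold Function.uncurry
    fun_prop
  exact Measurable.mul (by fun_prop) h.lintegral_prod_right

lemma radialWeight_eq (α : ℝ) {r : ℝ} (hr : r ∈ Ioo (0 : ℝ) 1) :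
    radialWeight α r =
      ∫⁻ u in Ioo 0 (1 - r ^ 2), ENNReal.ofReal (u ^ (α + 1) / (1 - u)) := by
  have hw : 0 < 1 - r ^ 2 := by nlinarith [hr.1, hr.2]
  have himg : Ioo 0 (1 - r ^ 2) = (fun s ↦ (1 - r ^ 2) * s) '' Ioo (0 : ℝ) 1 := by
    rw [image_mul_left_Ioo hw, mul_zero, mul_one]
  have hderiv (x : ℝ) (_ : x ∈ Ioo (0 : ℝ) 1) :
      HasDerivWithinAt (fun s ↦ (1 - r ^ 2) * s) (1 - r ^ 2) (Ioo 0 1) x := by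
    simpa using ((hasDerivAt_id x).const_mul (1 - r ^ 2)).hasDerivWithinAt
  rw [himg, lintegral_image_eq_lintegral_abs_deriv_mul measurableSet_Ioo hderiv
    (mul_right_injective₀ hw.ne').injOn, radialWeight, ← lintegral_const_mul _ (by fun_prop)]
  refine setLIntegral_congr_fun measurableSet_Ioo fun s hs ↦ ?_
  rw [← ENNReal.ofReal_mul (by positivity), ← ENNReal.ofReal_mul (by positivity), abs_of_pos hw,
    Real.mul_rpow hw.le hs.1.le, show α + 2 = (α + 1) + 1 by ring, Real.rpow_add_one hw.ne']
  ring_nf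

lemma lintegral_pow_Ioo {n : ℕ} {c : ℝ} (hc : 0 ≤ c) :
    ∫⁻ r in Ioo 0 c, ENNReal.ofReal (r ^ n) = ENNReal.ofReal (c ^ (n + 1) / (n + 1)) := by
  rw [← ofReal_integral_eq_lintegral_ofReal]
  · rw [← integral_Ioc_eq_integral_Ioo, ← intervalIntegral.integral_of_le hc, integral_pow]
    simp
  · exact ((continuous_pow n).integrableOn_Icc (a := 0) (b := c)).mono_set Ioo_subset_Icc_self
  · exact (ae_restrict_iff' measurableSet_Ioo).mpr (.of_forall fun r hr ↦ pow_nonneg hr.1.le n)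

lemma lintegral_rpow_mul_one_sub_rpow {a b : ℝ} (ha : 0 < a) (hb : 0 < b) :
    ∫⁻ x in Ioo (0 : ℝ) 1, ENNReal.ofReal (x ^ (a - 1) * (1 - x) ^ (b - 1)) =
      ENNReal.ofReal (ProbabilityTheory.beta a b) := by
  have hβ := ProbabilityTheory.beta_pos ha hb
  have h := ProbabilityTheory.lintegral_betaPDF_eq_one ha hb
  simp_rw [ProbabilityTheory.lintegral_betaPDF, mul_assoc,
    ENNReal.ofReal_mul (one_div_pos.mpr hβ).le] at h
  rw [lintegral_const_mul _ (by fun_prop), one_div, ENNReal.ofReal_inv_of_pos hβ,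
    mul_comm, ← div_eq_mul_inv] at h
  exact (ENNReal.div_eq_one_iff (by simpa using hβ) ENNReal.ofReal_ne_top).mp h

lemma lintegral_pow_mul_radialWeight {α : ℝ} (hα : -1 ≤ α) (n : ℕ) :
    ∫⁻ r in Ioo (0 : ℝ) 1, ENNReal.ofReal (r ^ (2 * n + 1)) * radialWeight α r =
      ENNReal.ofReal (ProbabilityTheory.beta (α + 2) (n + 1) / (2 * (n + 1))) := by
  set S : Set (ℝ × ℝ) := {p | p.1 ^ 2 + p.2 < 1} with hS
  have hSm : MeasurableSet S :=
    measurableSet_lt (by fun_prop) measurable_const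
  set K : ℝ × ℝ → ℝ≥0∞ := S.indicator fun p ↦
    ENNReal.ofReal (p.1 ^ (2 * n + 1)) * ENNReal.ofReal (p.2 ^ (α + 1) / (1 - p.2)) with hK
  have hKm : Measurable K := Measurable.indicator (by fun_prop) hSm
  calc
    _ = ∫⁻ r in Ioo (0 : ℝ) 1, ∫⁻ u in Ioo (0 : ℝ) 1, K (r, u) := by
      refine setLIntegral_congr_fun measurableSet_Ioo fun r hr ↦ ?_
      have hind : (fun u ↦ K (r, u)) = (Iio (1 - r ^ 2)).indicator fun u ↦
          ENNReal.ofReal (r ^ (2 * n + 1)) * ENNReal.ofReal (u ^ (α + 1) / (1 - u)) := by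
        ext u
        simp only [hK, hS, indicator_apply, mem_ofPred_eq, mem_Iio, lt_sub_iff_add_lt']
      simp only [radialWeight_eq α hr, hind]
      rw [lintegral_indicator measurableSet_Iio, Measure.restrict_restrict measurableSet_Iio,
        lintegral_const_mul _ (by fun_prop), Iio_inter_Ioo, min_eq_left (by nlinarith [hr.1])]
    _ = ∫⁻ u in Ioo (0 : ℝ) 1, ∫⁻ r in Ioo (0 : ℝ) 1, K (r, u) :=
      lintegral_lintegral_swap hKm.aemeasurable
    _ = ∫⁻ u in Ioo (0 : ℝ) 1, ENNReal.ofReal (1 / (2 * (n + 1))) *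
          ENNReal.ofReal (u ^ (α + 2 - 1) * (1 - u) ^ ((n + 1 : ℝ) - 1)) := by
      refine setLIntegral_congr_fun measurableSet_Ioo fun u hu ↦ ?_
      have hu1 : 0 < 1 - u := sub_pos.mpr hu.2
      have hind : EqOn (fun r ↦ K (r, u)) ((Iio (√(1 - u))).indicator fun r ↦
          ENNReal.ofReal (r ^ (2 * n + 1)) * ENNReal.ofReal (u ^ (α + 1) / (1 - u)))
          (Ioo 0 1) := by
        intro r hr
        simp only [hK, hS, indicator_apply, mem_ofPred_eq, mem_Iio, Real.lt_sqrt hr.1.le,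
          lt_sub_iff_add_lt]
      have hsqrt : √(1 - u) ≤ 1 := Real.sqrt_le_one.mpr (by linarith [hu.1])
      rw [setLIntegral_congr_fun measurableSet_Ioo hind, lintegral_indicator measurableSet_Iio,
        Measure.restrict_restrict measurableSet_Iio, lintegral_mul_const _ (by fun_prop),
        Iio_inter_Ioo, min_eq_left hsqrt, lintegral_pow_Ioo (Real.sqrt_nonneg _),
        ← ENNReal.ofReal_mul (by positivity), ← ENNReal.ofReal_mul (by positivity),
        show 2 * n + 1 + 1 = 2 * (n + 1) by ring, pow_mul, Real.sq_sqrt hu1.le,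
        add_sub_cancel_right, Real.rpow_natCast, show α + 2 - 1 = α + 1 by ring, pow_succ]
      congr 1
      push_cast
      field_simp
      ring
    _ = _ := by
      rw [lintegral_const_mul _ (by fun_prop),
        lintegral_rpow_mul_one_sub_rpow (by linarith) (by positivity),
        ← ENNReal.ofReal_mul (by positivity), one_div_mul_eq_div]

/-- One half of the Littlewood-Paley identity. -/
lemma lintegral_deriv_sq_radialWeight_le {α : ℝ} (hα : -1 ≤ α) {f : ℂ → ℂ}
    (hf : DifferentiableOn ℂ f unitDisk) :
    ∫⁻ z in unitDisk, ENNReal.ofReal (‖deriv f z‖ ^ 2) * radialWeight α ‖z‖ ≤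
      ENNReal.ofReal Real.pi *
        ∑' n, ENNReal.ofReal (‖taylorCoeff f (n + 1)‖ ^ 2 / ccoef (α + 2) (n + 1)) := by
  have hsum (z : ℂ) (hz : z ∈ unitDisk) :
      HasSum (fun n : ℕ ↦ (n + 1) * taylorCoeff f (n + 1) * z ^ n) (deriv f z) := by
    have hcoeff (n : ℕ) : (n + 1) * taylorCoeff f (n + 1) * z ^ n =
        (n.factorial : ℂ)⁻¹ • (z - 0) ^ n • iteratedDeriv n (deriv f) 0 := by
      have hn : (n.factorial : ℂ) ≠ 0 := by exact_mod_cast n.factorial_ne_zero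
      have hn1 : (n + 1 : ℂ) ≠ 0 := by exact_mod_cast n.succ_ne_zero
      rw [taylorCoeff, iteratedDeriv_succ', Nat.factorial_succ]
      push_cast
      simp only [smul_eq_mul, sub_zero]
      field_simp
    simp_rw [hcoeff]
    exact Complex.hasSum_taylorSeries_on_ball (hf.deriv Metric.isOpen_ball) hz
  refine (lintegral_unitDisk_radial_le (measurable_deriv f) hsum
    (measurable_radialWeight_s4 α)).trans_eq ?_
  rw [← ENNReal.tsum_mul_left]
  congr 1 with n
  rw [lintegral_pow_mul_radialWeight hα, ← ENNReal.ofReal_mul (by positivity),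
    ← ENNReal.ofReal_mul (by positivity)]
  have hΓ : Real.Gamma (α + 2) ≠ 0 := (Real.Gamma_pos_of_pos (by linarith)).ne'
  have hΓ' : Real.Gamma (α + 2 + (n + 1)) ≠ 0 :=
    (Real.Gamma_pos_of_pos (by linarith [n.cast_nonneg (α := ℝ)])).ne'
  have hfac : (n.factorial : ℝ) ≠ 0 := by exact_mod_cast n.factorial_ne_zero
  have hn : ‖(n + 1 : ℂ)‖ = n + 1 := by exact_mod_cast Complex.norm_natCast (n + 1)
  rw [ccoef, ProbabilityTheory.beta, Real.Gamma_nat_eq_factorial, Nat.factorial_succ, norm_mul, hn]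
  push_cast
  rw [add_comm (n + 1 : ℝ) (α + 2)]
  congr 1
  field_simp

lemma rpow_add_mul_rpow_mul_one_sub_sq_lt_one {p x : ℝ} (hp : 2 < p) (hx : 0 ≤ x) (hx1 : x < 1) :
    x ^ p + p / 2 * (x ^ (p - 2) * (1 - x ^ 2)) < 1 := by
  rcases hx.eq_or_lt with rfl | hx0
  · simp [Real.zero_rpow (by linarith : p ≠ 0), Real.zero_rpow (by linarith : p - 2 ≠ 0)]
  · have hinv : 1 < (x ^ 2)⁻¹ := (one_lt_inv₀ (by positivity)).mpr (by nlinarith)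
    have h := one_add_mul_self_lt_rpow_one_add (by linarith : -1 ≤ (x ^ 2)⁻¹ - 1)
      (by linarith) (by linarith : 1 < p / 2)
    rw [add_sub_cancel, Real.inv_rpow (by positivity), ← Real.rpow_natCast_mul hx,
      show ((2 : ℕ) : ℝ) * (p / 2) = p by push_cast; ring] at h
    have hp0 : 0 < x ^ p := Real.rpow_pos_of_pos hx0 p
    have hsplit : x ^ p = x ^ (p - 2) * x ^ 2 := by
      rw [← Real.rpow_natCast, ← Real.rpow_add hx0]
      norm_num
    calc
      _ = x ^ p * (1 + p / 2 * ((x ^ 2)⁻¹ - 1)) := by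
        rw [hsplit]
        field_simp
      _ < x ^ p * (x ^ p)⁻¹ := by gcongr
      _ = 1 := mul_inv_cancel₀ hp0.ne'

lemma ccoef_pos_s4 {β : ℝ} (hβ : 0 < β) (n : ℕ) : 0 < ccoef β n :=
  div_pos (Real.Gamma_pos_of_pos (by positivity))
    (mul_pos (Real.Gamma_pos_of_pos hβ) (by exact_mod_cast n.factorial_pos))

lemma ccoef_zero {β : ℝ} (hβ : 0 < β) : ccoef β 0 = 1 := by
  rw [ccoef, Nat.cast_zero, zero_add, Nat.factorial_zero, Nat.cast_one, mul_one,
    div_self (Real.Gamma_pos_of_pos hβ).ne']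

lemma A2normSq_eq_add {α : ℝ} (hα : -1 ≤ α) (f : ℂ → ℂ) :
    A2normSq α f = ENNReal.ofReal (‖f 0‖ ^ 2) +
      ∑' n, ENNReal.ofReal (‖taylorCoeff f (n + 1)‖ ^ 2 / ccoef (α + 2) (n + 1)) := by
  have h0 : taylorCoeff f 0 = f 0 := by
    rw [taylorCoeff, iteratedDeriv_zero, Nat.factorial_zero, Nat.cast_one, div_one]
  rw [A2normSq, tsum_eq_zero_add' ENNReal.summable, ccoef_zero (by linarith), h0, div_one]

/-- The defect of `F_p` is controlled by the non-constant part of the norm. -/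
lemma Ffun_le {α p : ℝ} (hα : -1 ≤ α) (hp : 2 < p) {f : ℂ → ℂ}
    (hf : DifferentiableOn ℂ f unitDisk)
    (hmax : ∀ z ∈ unitDisk, ‖f z‖ * (1 - ‖z‖ ^ 2) ^ ((α + 2) / 2) ≤ ‖f 0‖) :
    Ffun α p f ≤ ENNReal.ofReal (‖f 0‖ ^ p) + ENNReal.ofReal (p / 2) *
      (ENNReal.ofReal (‖f 0‖ ^ (p - 2)) *
        ∑' n, ENNReal.ofReal (‖taylorCoeff f (n + 1)‖ ^ 2 / ccoef (α + 2) (n + 1))) := by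
  rw [Ffun, mul_div_assoc]
  gcongr
  refine ENNReal.div_le_of_le_mul ?_
  rw [mul_assoc, mul_comm _ (ENNReal.ofReal Real.pi)]
  calc
    _ ≤ ∫⁻ z in unitDisk, ENNReal.ofReal (‖f 0‖ ^ (p - 2)) *
        (ENNReal.ofReal (‖deriv f z‖ ^ 2) * radialWeight α ‖z‖) := by
      refine setLIntegral_mono' measurableSet_ball fun z hz ↦ ?_
      have hz1 : ‖z‖ < 1 := by simpa [unitDisk] using hz
      have hw : 0 < 1 - ‖z‖ ^ 2 := by nlinarith [norm_nonneg z]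
      rw [radialWeight, Hinner, ← mul_assoc, ← mul_assoc,
        ← ENNReal.ofReal_mul (by positivity), ← ENNReal.ofReal_mul (by positivity)]
      refine mul_le_mul_left (ENNReal.ofReal_le_ofReal ?_) _
      have hsplit : (1 - ‖z‖ ^ 2) ^ (p * (α + 2) / 2) =
          ((1 - ‖z‖ ^ 2) ^ ((α + 2) / 2)) ^ (p - 2) * (1 - ‖z‖ ^ 2) ^ (α + 2) := by
        rw [← Real.rpow_mul hw.le, ← Real.rpow_add hw]
        ring_nf
      calc
        _ = (‖f z‖ * (1 - ‖z‖ ^ 2) ^ ((α + 2) / 2)) ^ (p - 2) * ‖deriv f z‖ ^ 2 *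
            (1 - ‖z‖ ^ 2) ^ (α + 2) := by
          rw [hsplit, Real.mul_rpow (norm_nonneg _) (by positivity)]
          ring
        _ ≤ _ := by
          gcongr
          exact hmax z hz
    _ ≤ _ := by
      have hW : Measurable fun z : ℂ ↦ radialWeight α ‖z‖ :=
        (measurable_radialWeight_s4 α).comp measurable_norm
      rw [lintegral_const_mul _ (by fun_prop)]
      exact mul_le_mul_right (lintegral_deriv_sq_radialWeight_le hα hf) _

lemma taylorCoeff_succ_eq_zero_of_eqOn_const {f : ℂ → ℂ} {c : ℂ}
    (h : EqOn f (fun _ ↦ c) unitDisk) (n : ℕ) : taylorCoeff f (n + 1) = 0 := by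
  have h0 : f =ᶠ[𝓝 0] fun _ ↦ c :=
    h.eventuallyEq_of_mem (Metric.ball_mem_nhds 0 one_pos)
  rw [taylorCoeff, h0.iteratedDeriv_eq]
  simp [iteratedDeriv_const]

lemma eqOn_const_of_taylorCoeff_succ_eq_zero {f : ℂ → ℂ} (hf : DifferentiableOn ℂ f unitDisk)
    (h : ∀ n, taylorCoeff f (n + 1) = 0) : EqOn f (fun _ ↦ f 0) unitDisk := by
  intro z hz
  have hsum := Complex.hasSum_taylorSeries_on_ball hf hz
  have hzero (n : ℕ) (hn : n ≠ 0) :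
      (n.factorial : ℂ)⁻¹ • (z - 0) ^ n • iteratedDeriv n f 0 = 0 := by
    obtain ⟨m, rfl⟩ := Nat.exists_eq_succ_of_ne_zero hn
    have hm := h m
    rw [taylorCoeff, div_eq_zero_iff, or_iff_left (by exact_mod_cast Nat.factorial_ne_zero _)] at hm
    simp [hm]
  simpa using hsum.unique (hasSum_single 0 hzero)

/-- if ‖f‖_{A²_α} = 1 and |f(0)| is the maximum of |f(z)|(1-|z|²)^{(α+2)/2}
over 𝔻, then F_p(f) ≤ 1, with equality iff f is constant. -/
theorem statement4 (α p : ℝ) (hα : -1 ≤ α) (hp : 2 < p) (f : ℂ → ℂ)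
    (hf : DifferentiableOn ℂ f unitDisk) (hnorm : A2norm α f = 1)
    (hmax : ∀ z ∈ unitDisk, ‖f z‖ * (1 - ‖z‖ ^ 2) ^ ((α + 2) / 2) ≤ ‖f 0‖) :
    Ffun α p f ≤ 1 ∧ (Ffun α p f = 1 ↔ ∃ c : ℂ, Set.EqOn f (fun _ => c) unitDisk) := by
  have hsq : A2normSq α f = 1 := by
    have h := congrArg (fun t : ℝ≥0∞ ↦ t ^ (2 : ℝ)) hnorm
    simp only [A2norm, ← ENNReal.rpow_mul, ENNReal.one_rpow] at h
    norm_num at h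
    exact h
  have hle := Ffun_le hα hp hf hmax
  rw [A2normSq_eq_add hα] at hsq
  set T := ∑' n, ENNReal.ofReal (‖taylorCoeff f (n + 1)‖ ^ 2 / ccoef (α + 2) (n + 1)) with hT
  have hx := norm_nonneg (f 0)
  have hx1 : ‖f 0‖ ≤ 1 := by
    have h : ENNReal.ofReal (‖f 0‖ ^ 2) ≤ 1 := hsq ▸ le_self_add
    rw [ENNReal.ofReal_le_one] at h
    exact (sq_le_one_iff₀ hx).mp h
  have hTx : T = ENNReal.ofReal (1 - ‖f 0‖ ^ 2) := by
    rw [ENNReal.ofReal_sub _ (by positivity), ENNReal.ofReal_one, ← hsq,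
      ENNReal.add_sub_cancel_left ENNReal.ofReal_ne_top]
  have hlt (h : ‖f 0‖ < 1) : Ffun α p f < 1 := by
    refine hle.trans_lt ?_
    have h1 : 0 ≤ 1 - ‖f 0‖ ^ 2 := by nlinarith
    have h2 : 0 ≤ p / 2 := by linarith
    rw [hTx, ← ENNReal.ofReal_mul (by positivity), ← ENNReal.ofReal_mul h2,
      ← ENNReal.ofReal_add (by positivity) (by positivity), ENNReal.ofReal_lt_one]
    exact rpow_add_mul_rpow_mul_one_sub_sq_lt_one hp hx h
  have hle1 : Ffun α p f ≤ 1 := by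
    rcases hx1.lt_or_eq with h | h
    · exact (hlt h).le
    · simpa [hTx, h] using hle
  refine ⟨hle1, fun hF ↦ ⟨f 0, ?_⟩, ?_⟩
  · have h : ‖f 0‖ = 1 := hx1.eq_of_not_lt fun h ↦ (hlt h).ne hF
    have hT0 : T = 0 := by simp [hTx, h]
    refine eqOn_const_of_taylorCoeff_succ_eq_zero hf fun n ↦ ?_
    have hn := ENNReal.tsum_eq_zero.mp hT0 n
    have hc := ccoef_pos_s4 (by linarith : 0 < α + 2) (n + 1)
    rw [ENNReal.ofReal_eq_zero, div_le_iff₀ hc, zero_mul] at hn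
    simpa using hn.antisymm (by positivity)
  · rintro ⟨c, hc⟩
    have hT0 : T = 0 := by
      simp [hT, taylorCoeff_succ_eq_zero_of_eqOn_const hc]
    refine hle1.antisymm ?_
    rw [hT0, add_zero, ENNReal.ofReal_eq_one, pow_eq_one_iff_of_nonneg hx two_ne_zero] at hsq
    rw [Ffun, hsq, Real.one_rpow, ENNReal.ofReal_one]
    exact le_self_add

end
end
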